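/- arXiv:1908.11533 — 2 statements merged into one kernel-verified Lean document; each statement's English description precedes it below -/
import Mathlib

section
/- Let h ∈ (0,1], ε ∈ (0,1/(2N)), ε₀ > 0, and w ∈ ℝᴺ with wⁱ ∈ [0,1] for all i and Σ_i wⁱ ≥ 1. Then the map w_{h,ε} is differentiable on 𝒦^ε; for every ψ ∈ 𝒩_{w,h,ε} ∩ 𝒲^{ε₀} the Jacobian matrix Dw_{h,ε}(ψ) is invertible; and there is a constant C > 0, depending only on n, N, α, X, Y, c and μ, such that sup_{ψ ∈ 𝒩_{w,h,ε} ∩ 𝒲^{ε₀}} ‖Dw_{h,ε}(ψ)^{-1}‖ ≤ C · ε₀^{-1} · h^{-6} · ε^{-3/2}, where ‖·‖ is the operator norm. -/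
open MeasureTheory Metric Set Filter
open scoped Classical

noncomputable section

abbrev Pt (n : ℕ) := EuclideanSpace ℝ (Fin n)

/-- The function `g(t) = 2(1 + t² − t√(1+t²))`. -/
def gfun (t : ℝ) : ℝ := 2 * (1 + t ^ 2 - t * Real.sqrt (1 + t ^ 2))

variable {n N : ℕ}

/-- The `i`-th Laguerre cell associated to `ψ`. -/
def LagCell (X : Set (Pt n)) (c : Pt n → Fin N → ℝ) (ψ : Fin N → ℝ) (i : Fin N) :
    Set (Pt n) :=
  {x ∈ X | -c x i - ψ i = ⨆ j, (-c x j - ψ j)}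

/-- `G(ψ) = (μ(Lag_1(ψ)),…,μ(Lag_N(ψ)))`. -/
def Gfun (X : Set (Pt n)) (c : Pt n → Fin N → ℝ) (μ : Measure (Pt n)) (ψ : Fin N → ℝ)
    (i : Fin N) : ℝ := (μ (LagCell X c ψ i)).toReal

/-- `𝒦^ε = {ψ : Gⁱ(ψ) > ε for all i}`. -/
def Kset (X : Set (Pt n)) (c : Pt n → Fin N → ℝ) (μ : Measure (Pt n)) (ε : ℝ) :
    Set (Fin N → ℝ) := {ψ | ∀ i, ε < Gfun X c μ ψ i}

/-- `wⁱ_{h,ε}(ψ) = (Gⁱ(ψ) − ε)·g(ψⁱ/h)`. -/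
def wmap (X : Set (Pt n)) (c : Pt n → Fin N → ℝ) (μ : Measure (Pt n)) (h ε : ℝ)
    (ψ : Fin N → ℝ) : Fin N → ℝ := fun i => (Gfun X c μ ψ i - ε) * gfun (ψ i / h)

/-- `𝒩_{w,h,ε} = {ψ ∈ 𝒦^ε : Σ wⁱ = Σ wⁱ_{h,ε}(ψ)}`. -/
def Nset (X : Set (Pt n)) (c : Pt n → Fin N → ℝ) (μ : Measure (Pt n)) (h ε : ℝ)
    (w : Fin N → ℝ) : Set (Fin N → ℝ) :=
  {ψ ∈ Kset X c μ ε | ∑ i, w i = ∑ i, wmap X c μ h ε ψ i}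

/-- `𝒲^{ε₀} = {ψ : wⁱ_{h,ε}(ψ) ≥ ε₀ for all i}`. -/
def Wset (X : Set (Pt n)) (c : Pt n → Fin N → ℝ) (μ : Measure (Pt n)) (h ε ε₀ : ℝ) :
    Set (Fin N → ℝ) := {ψ | ∀ i, ε₀ ≤ wmap X c μ h ε ψ i}

/-- Euclidean (ℓ²) norm on `ℝᴺ`. -/
def eNorm2 (v : Fin N → ℝ) : ℝ := Real.sqrt (∑ i, v i ^ 2)

/-- ℓ¹ norm on `ℝᴺ`. -/
def l1Norm (v : Fin N → ℝ) : ℝ := ∑ i, |v i|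

/-- `T_#μ = Σ βⁱ δ_{y_i}`, with target points recorded by their indices. -/
def IsPush (μ : Measure (Pt n)) (T : Pt n → Fin N) (β : Fin N → ℝ) : Prop :=
  ∀ i, μ (T ⁻¹' {i}) = ENNReal.ofReal (β i)

/-- `(T,β)` minimizes the optimal transport problem with storage fee `F`. -/
def MinimizesStorage (c : Pt n → Fin N → ℝ) (μ : Measure (Pt n))
    (F : (Fin N → ℝ) → EReal) (T : Pt n → Fin N) (β : Fin N → ℝ) : Prop :=
  Measurable T ∧ IsPush μ T β ∧
    ∀ (T' : Pt n → Fin N) (β' : Fin N → ℝ), Measurable T' → IsPush μ T' β' →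
      ((∫ x, c x (T x) ∂μ : ℝ) : EReal) + F β ≤ ((∫ x, c x (T' x) ∂μ : ℝ) : EReal) + F β'

/-- The storage fee `F_w`: indicator of the box `Π [0, wⁱ]`. -/
def Fw (w β : Fin N → ℝ) : EReal := if ∀ i, β i ∈ Icc 0 (w i) then 0 else ⊤

/-- The standard simplex `Δ_N`. -/
def simplexSet (N : ℕ) : Set (Fin N → ℝ) := {β | ∑ i, β i = 1 ∧ ∀ i, 0 ≤ β i}

/-- The smoothed storage fee `F_{w,h,ε}`. -/
def Fwhe (w : Fin N → ℝ) (h ε : ℝ) (β : Fin N → ℝ) : EReal :=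
  if β ∈ simplexSet N ∧ ∀ i, β i ∈ Icc ε (w i + ε) then
    (((-h) * ∑ i, Real.sqrt ((β i - ε) * (w i - β i + ε)) : ℝ) : EReal)
  else ⊤

/-- (Reg): each `c(·,y_i)` is `C²` on `X`. -/
def RegCond (X : Set (Pt n)) (c : Pt n → Fin N → ℝ) : Prop :=
  ∀ i, ContDiffOn ℝ 2 (fun x => c x i) X

/-- (Twist): the gradients `∇_x c(x,y_i)` are pairwise distinct. -/
def TwistCond (X : Set (Pt n)) (c : Pt n → Fin N → ℝ) : Prop :=
  ∀ x ∈ X, ∀ i k : Fin N, i ≠ k →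
    fderivWithin ℝ (fun y => c y i) X x ≠ fderivWithin ℝ (fun y => c y k) X x

/-- Loeper's condition (QC), together with `c`-convexity of `X` with respect to `Y`. -/
def LoeperCond (X : Set (Pt n)) (c : Pt n → Fin N → ℝ) : Prop :=
  ∃ (Xi : Fin N → Set (Pt n)) (expc iexpc : Fin N → Pt n → Pt n),
    ∀ i, Convex ℝ (Xi i) ∧ ContDiffOn ℝ 2 (expc i) (Xi i) ∧
      ContDiffOn ℝ 2 (iexpc i) X ∧ Set.BijOn (expc i) (Xi i) X ∧
      Set.InvOn (iexpc i) (expc i) (Xi i) X ∧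
      ∀ (t : ℝ) (k : Fin N), Convex ℝ {p ∈ Xi i | -c (expc i p) k + c (expc i p) i ≤ t}

/-- `μ = ρ dx` for a `C^{0,α}` density `ρ`. -/
def HolderDensity (X : Set (Pt n)) (μ : Measure (Pt n)) (α : ℝ) : Prop :=
  ∃ ρ : Pt n → ℝ, μ = volume.withDensity (fun x => ENNReal.ofReal (ρ x)) ∧
    ContinuousOn ρ X ∧ ∃ Cρ : ℝ, ∀ x ∈ X, ∀ y ∈ X, |ρ x - ρ y| ≤ Cρ * ‖x - y‖ ^ α

/-- `(q,1)`-Poincaré–Wirtinger inequality with constant `CPW`. -/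
def PWineq (μ : Measure (Pt n)) (q CPW : ℝ) : Prop :=
  ∀ f : Pt n → ℝ, ContDiff ℝ 1 f →
    (∫ x, |f x - ∫ y, f y ∂μ| ^ q ∂μ) ^ (1 / q) ≤ CPW * ∫ x, ‖fderiv ℝ f x‖ ∂μ

/-- `T` agrees `μ`-a.e. with the Laguerre-cell map `T_ψ`. -/
def AgreesAE (X : Set (Pt n)) (c : Pt n → Fin N → ℝ) (μ : Measure (Pt n))
    (ψ : Fin N → ℝ) (T : Pt n → Fin N) : Prop :=
  ∀ᵐ x ∂μ, x ∈ LagCell X c ψ (T x)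

/-- The Kantorovich transport-cost functional `𝒞`. -/
def Cfun (c : Pt n → Fin N → ℝ) (μ : Measure (Pt n)) (β : Fin N → ℝ) : ℝ :=
  ⨆ ψ : Fin N → ℝ, (-(∫ x, (⨆ i, (-c x i - ψ i)) ∂μ) - ∑ i, ψ i * β i)

/-- One step of the damped Newton algorithm with parameters `h, ε, ε₀, w`. -/
def NewtonIter (X : Set (Pt n)) (c : Pt n → Fin N → ℝ) (μ : Measure (Pt n))
    (h ε ε₀ : ℝ) (w : Fin N → ℝ) (ψ ψ' : Fin N → ℝ) : Prop :=
  ∃ A : (Fin N → ℝ) ≃L[ℝ] (Fin N → ℝ),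
    (A : (Fin N → ℝ) →L[ℝ] (Fin N → ℝ)) = fderiv ℝ (wmap X c μ h ε) ψ ∧
    ∃ (ℓ : ℕ) (r : ℝ),
      ψ' = ψ - ((2 : ℝ)⁻¹ ^ ℓ) • A.symm (wmap X c μ h ε ψ - w) + r • (fun _ => (1 : ℝ)) ∧
      ψ' ∈ Nset X c μ h ε w ∧ (∀ i, ε₀ ≤ wmap X c μ h ε ψ' i) ∧
      eNorm2 (wmap X c μ h ε ψ' - w) ≤
        (1 - (2 : ℝ)⁻¹ ^ (ℓ + 1)) * eNorm2 (wmap X c μ h ε ψ - w) ∧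
      ∀ ℓ' < ℓ, ∀ r' : ℝ,
        (ψ - ((2 : ℝ)⁻¹ ^ ℓ') • A.symm (wmap X c μ h ε ψ - w) + r' • (fun _ => (1 : ℝ)))
          ∈ Nset X c μ h ε w →
        ¬((∀ i, ε₀ ≤ wmap X c μ h ε
              (ψ - ((2 : ℝ)⁻¹ ^ ℓ') • A.symm (wmap X c μ h ε ψ - w)
                + r' • (fun _ => (1 : ℝ))) i) ∧
          eNorm2 (wmap X c μ h ε
              (ψ - ((2 : ℝ)⁻¹ ^ ℓ') • A.symm (wmap X c μ h ε ψ - w)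
                + r' • (fun _ => (1 : ℝ))) - w) ≤
            (1 - (2 : ℝ)⁻¹ ^ (ℓ' + 1)) * eNorm2 (wmap X c μ h ε ψ - w))

open scoped Topology

lemma null_of_oneSided {A : Set (Pt n)}
    (h : ∀ p ∈ A, ∃ m : Pt n →L[ℝ] ℝ, m ≠ 0 ∧
      ∀ η > 0, ∀ᶠ p' in 𝓝[A] p, m (p' - p) ≤ η * ‖p' - p‖) : volume A = 0 := by
  have hd := Besicovitch.ae_tendsto_measure_inter_div (volume : Measure (Pt n)) A
  have key : ∀ p ∈ A, ¬ Tendsto (fun r => volume (A ∩ closedBall p r) / volume (closedBall p r))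
      (𝓝[>] 0) (𝓝 1) := by
    intro p hp ht
    obtain ⟨m, hm0, hm⟩ := h p hp
    obtain ⟨v, hv⟩ : ∃ v, 0 < m v := by
      obtain ⟨v, hv⟩ : ∃ v, m v ≠ 0 := by
        by_contra hcon
        push Not at hcon
        exact hm0 (ContinuousLinearMap.ext hcon)
      rcases lt_or_gt_of_ne hv with h1 | h1
      · exact ⟨-v, by simpa using h1⟩
      · exact ⟨v, h1⟩
    set t : Set (Pt n) := {y | m v / 2 < m y ∧ ‖y‖ < ‖v‖ + 1} with ht_def
    have topen : IsOpen t :=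
      (isOpen_lt continuous_const m.continuous).inter (isOpen_lt continuous_norm continuous_const)
    have tne : t.Nonempty := ⟨v, by constructor <;> linarith⟩
    have h1 := Measure.eventually_nonempty_inter_smul_of_density_one volume A p ht t
      topen.measurableSet (topen.measure_pos _ tne).ne'
    have hη : 0 < m v / (4 * (‖v‖ + 1)) := by positivity
    have h2 := hm _ hη
    rw [eventually_nhdsWithin_iff, Metric.eventually_nhds_iff] at h2
    obtain ⟨d, hd, h2⟩ := h2
    have h3 : ∀ᶠ r in 𝓝[>] (0:ℝ), r < d / (‖v‖ + 1) :=
      nhdsWithin_le_nhds (Iio_mem_nhds (by positivity))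
    obtain ⟨r, ⟨q, hqA, hq⟩, hr1, hr0⟩ := (h1.and (h3.and self_mem_nhdsWithin)).exists
    have hr0 : 0 < r := hr0
    rw [Set.singleton_add, mem_image] at hq
    obtain ⟨z, hz, rfl⟩ := hq
    obtain ⟨y, ⟨hy1, hy2⟩, rfl⟩ := hz
    have hlt : ‖r • y‖ < r * (‖v‖ + 1) := by
      rw [norm_smul, Real.norm_of_nonneg hr0.le]
      exact mul_lt_mul_of_pos_left hy2 hr0
    have h4 := h2 (y := p + r • y) (by
      rw [dist_eq_norm]; simp only [add_sub_cancel_left]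
      have : r * (‖v‖ + 1) < d := by rwa [lt_div_iff₀ (by positivity)] at hr1
      exact hlt.trans this) hqA
    simp only [add_sub_cancel_left, map_smul, smul_eq_mul] at h4
    have h5 : m v / (4 * (‖v‖ + 1)) * ‖r • y‖ ≤ m v / (4 * (‖v‖ + 1)) * (r * (‖v‖ + 1)) :=
      mul_le_mul_of_nonneg_left hlt.le hη.le
    have h6 : m v / (4 * (‖v‖ + 1)) * (r * (‖v‖ + 1)) = r * (m v / 4) := by
      field_simp
    have h7 : r * (m v / 2) < r * m y := mul_lt_mul_of_pos_left hy1 hr0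
    nlinarith
  by_contra hA
  have : (ae (volume.restrict A)).NeBot := by
    rw [ae_neBot]
    intro h0
    exact hA (by simpa using h0)
  -- need a point of A satisfying hd
  have h8 : volume ({x | ¬ Tendsto (fun r => volume (A ∩ closedBall x r) / volume (closedBall x r))
      (𝓝[>] 0) (𝓝 1)} ∩ A) = 0 := by
    have := ae_iff.1 hd
    exact le_antisymm ((Measure.le_restrict_apply _ _).trans this.le) bot_le
  apply hA
  refine measure_mono_null ?_ h8
  intro p hp
  exact ⟨key p hp, hp⟩

lemma differentiableAt_integral_of_lip {ι α : Type*} [Fintype ι] [MeasurableSpace α]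
    {ν : Measure α} {F : (ι → ℝ) → α → ℝ} {x₀ : ι → ℝ} {bound : α → ℝ}
    (hF_int : ∀ x, Integrable (F x) ν)
    (hlip : ∀ᵐ a ∂ν, ∀ x y, |F x a - F y a| ≤ bound a * ‖x - y‖)
    (hbound : Integrable bound ν) (hb0 : ∀ a, 0 ≤ bound a)
    (hdiff : ∀ᵐ a ∂ν, DifferentiableAt ℝ (fun x => F x a) x₀) :
    DifferentiableAt ℝ (fun x => ∫ a, F x a ∂ν) x₀ := by
  have hmeas1 : ∀ v : ι → ℝ, AEStronglyMeasurable (fun a => fderiv ℝ (fun x => F x a) x₀ v) ν := by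
    intro v
    refine aestronglyMeasurable_of_tendsto_ae (u := atTop)
      (f := fun (k : ℕ) a => (k : ℝ) • (F (x₀ + (k : ℝ)⁻¹ • v) a - F x₀ a)) ?_ ?_
    · intro k
      exact (((hF_int _).sub (hF_int _)).aestronglyMeasurable.const_smul (k : ℝ))
    · filter_upwards [hdiff] with a ha
      exact ha.hasFDerivAt.lim_real v |>.comp tendsto_natCast_atTop_atTop
  have hmeas : AEStronglyMeasurable (fun a => fderiv ℝ (fun x => F x a) x₀) ν := by
    have : (fun a => fderiv ℝ (fun x => F x a) x₀) = fun a => ∑ i,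
        (fderiv ℝ (fun x => F x a) x₀ (Pi.single i 1)) •
          (ContinuousLinearMap.proj i : (ι → ℝ) →L[ℝ] ℝ) := by
      funext a
      ext v
      conv_lhs => rw [pi_eq_sum_univ' v]
      simp [mul_comm]
    rw [this]
    refine Finset.aestronglyMeasurable_fun_sum _ fun i _ => ?_
    exact (hmeas1 _).smul_const _
  exact (hasFDerivAt_integral_of_dominated_loc_of_lip (s := univ) univ_mem
    (Eventually.of_forall fun x => (hF_int x).aestronglyMeasurable) (hF_int x₀) hmeas
    (hlip.mono fun a ha => by
      rw [lipschitzOnWith_univ]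
      refine LipschitzWith.of_dist_le_mul fun x y => ?_
      rw [Real.dist_eq, dist_eq_norm, Real.coe_nnabs, abs_of_nonneg (hb0 a)]
      exact ha x y) hbound
    (hdiff.mono fun a ha => ha.hasFDerivAt)).2.differentiableAt

lemma one_d_single {J : Set ℝ} (hJc : IsCompact J) {f ω : ℝ → ℝ} {s0 δ : ℝ} (hδ : 0 < δ)
    (hf : ContinuousOn f J)
    (hmono : ∀ x ∈ J, ∀ y ∈ J, x ≤ y → δ * (y - x) ≤ f y - f x)
    (hω : IntegrableOn ω J)
    (ht : ∀ t ∈ J, f t = s0 → (J ∈ 𝓝 t ∧ ContinuousAt ω t ∧ ∃ m, m ≠ 0 ∧ HasDerivAt f m t) ∨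
      ∀ᶠ x in 𝓝 t, x ∈ J → ω x = 0) :
    DifferentiableAt ℝ (fun s => ∫ t in J, if f t ≤ s then ω t else 0) s0 := by
  have hJm : MeasurableSet J := hJc.measurableSet
  have hdist : ∀ x ∈ J, ∀ y ∈ J, δ * |y - x| ≤ |f y - f x| := by
    intro x hx y hy
    rcases le_total x y with h | h
    · rw [abs_of_nonneg (sub_nonneg.2 h)]
      exact (hmono x hx y hy h).trans (le_abs_self _)
    · rw [abs_sub_comm, abs_of_nonneg (sub_nonneg.2 h), abs_sub_comm]
      exact (hmono y hy x hx h).trans (le_abs_self _)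
  have hconst : (∀ᶠ s in 𝓝 s0, ∀ t ∈ J, ω t = 0 ∨ (f t ≤ s ↔ f t ≤ s0)) →
      DifferentiableAt ℝ (fun s => ∫ t in J, if f t ≤ s then ω t else 0) s0 := by
    intro h
    have : (fun s => ∫ t in J, if f t ≤ s then ω t else 0) =ᶠ[𝓝 s0]
        fun _ => ∫ t in J, if f t ≤ s0 then ω t else 0 := by
      filter_upwards [h] with s hs
      refine setIntegral_congr_fun hJm fun t htJ => ?_
      rcases hs t htJ with h0 | h0
      · simp [h0]
      · simp only [h0]
    exact this.differentiableAt_iff.2 (differentiableAt_const _)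
  by_cases hex : ∃ t ∈ J, f t = s0
  swap
  · push Not at hex
    apply hconst
    have hcl : IsClosed (f '' J) := (hJc.image_of_continuousOn hf).isClosed
    have hmem : (f '' J)ᶜ ∈ 𝓝 s0 := hcl.isOpen_compl.mem_nhds (by
      rintro ⟨t, h1, h2⟩; exact hex t h1 h2)
    obtain ⟨d, hd, hsub⟩ := Metric.mem_nhds_iff.1 hmem
    filter_upwards [Metric.ball_mem_nhds s0 hd] with s hs t htJ
    right
    have h1 : d ≤ |f t - s0| := by
      by_contra hlt
      push Not at hlt
      exact hsub (show f t ∈ Metric.ball s0 d by simpa [Real.dist_eq] using hlt) ⟨t, htJ, rfl⟩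
    rw [Metric.mem_ball, Real.dist_eq] at hs
    have hs1 := abs_lt.1 hs
    constructor
    · intro h2
      by_contra h3
      push Not at h3
      rw [abs_of_pos (by linarith)] at h1
      linarith
    · intro h2
      by_contra h3
      push Not at h3
      rw [abs_of_nonpos (by linarith)] at h1
      linarith
  obtain ⟨t0, ht0J, ht0⟩ := hex
  rcases ht t0 ht0J ht0 with ⟨hJn, hωc, m, hm0, hm⟩ | h0
  swap
  · apply hconst
    obtain ⟨d, hd, hsub⟩ := Metric.eventually_nhds_iff.1 h0
    filter_upwards [Metric.ball_mem_nhds s0 (mul_pos hδ hd)] with s hs t htJ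
    by_cases htd : dist t t0 < d
    · left; exact hsub htd htJ
    right
    push Not at htd
    rw [Real.dist_eq] at htd
    have h1 : δ * d ≤ |f t - s0| := by
      rw [← ht0]
      exact (mul_le_mul_of_nonneg_left htd hδ.le).trans (hdist _ ht0J _ htJ)
    rw [Metric.mem_ball, Real.dist_eq] at hs
    have hs1 := abs_lt.1 hs
    constructor
    · intro h2
      by_contra h3
      push Not at h3
      rw [abs_of_pos (by linarith)] at h1
      linarith
    · intro h2
      by_contra h3
      push Not at h3
      rw [abs_of_nonpos (by linarith)] at h1
      linarith
  obtain ⟨η, hη, hηJ⟩ := Metric.nhds_basis_closedBall.mem_iff.1 hJn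
  rw [Real.closedBall_eq_Icc] at hηJ
  have hb : ∀ s, ∃ b, s ∈ Icc (s0 - δ * η) (s0 + δ * η) → b ∈ J ∧ f b = s := by
    intro s
    by_cases hs : s ∈ Icc (s0 - δ * η) (s0 + δ * η)
    · have h1 := intermediate_value_Icc (by linarith : t0 - η ≤ t0 + η) (hf.mono hηJ)
      have ha := hmono (t0 - η) (hηJ ⟨by linarith, by linarith⟩) t0 ht0J (by linarith)
      have hb := hmono t0 ht0J (t0 + η) (hηJ ⟨by linarith, by linarith⟩) (by linarith)
      have e1 : t0 - (t0 - η) = η := by ring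
      have e2 : t0 + η - t0 = η := by ring
      rw [e1] at ha
      rw [e2] at hb
      obtain ⟨b, hb1, hb2⟩ := h1 (show s ∈ Icc _ _ from ⟨by linarith [hs.1], by linarith [hs.2]⟩)
      exact ⟨b, fun _ => ⟨hηJ hb1, hb2⟩⟩
    · exact ⟨0, fun h => absurd h hs⟩
  choose b hb using hb
  have hev : ∀ᶠ s in 𝓝 s0, s ∈ Icc (s0 - δ * η) (s0 + δ * η) :=
    Icc_mem_nhds (by nlinarith) (by nlinarith)
  have hs0 : s0 ∈ Icc (s0 - δ * η) (s0 + δ * η) := mem_of_mem_nhds hev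
  have hb0 : b s0 = t0 := by
    have h1 := hdist _ ht0J _ (hb s0 hs0).1
    rw [(hb s0 hs0).2, ht0, sub_self, abs_zero] at h1
    have h2 : |b s0 - t0| ≤ 0 := by
      by_contra h3
      push Not at h3
      nlinarith [mul_pos hδ h3]
    have := abs_nonpos_iff.1 h2
    linarith
  have hbc : ContinuousAt b s0 := by
    rw [ContinuousAt, hb0, tendsto_iff_dist_tendsto_zero]
    have hlim : Tendsto (fun s => |s - s0| / δ) (𝓝 s0) (𝓝 0) := by
      have : Continuous (fun s : ℝ => |s - s0| / δ) := by fun_prop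
      simpa using this.tendsto s0
    refine tendsto_of_tendsto_of_tendsto_of_le_of_le' tendsto_const_nhds hlim
      (Eventually.of_forall fun _ => dist_nonneg) ?_
    filter_upwards [hev] with s hs
    rw [le_div_iff₀ hδ, Real.dist_eq, mul_comm]
    have := hdist _ ht0J _ (hb s hs).1
    rwa [(hb s hs).2, ht0] at this
  have hbd : HasDerivAt b m⁻¹ s0 := by
    refine HasDerivAt.of_local_left_inverse hbc (f := f) (by rw [hb0]; exact hm) hm0 ?_
    filter_upwards [hev] with s hs using (hb s hs).2
  set W : ℝ → ℝ := J.indicator ω with hW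
  have hWi : Integrable W := by rwa [hW, integrable_indicator_iff hJm]
  have hWc : ContinuousAt W t0 := by
    refine hωc.congr ?_
    filter_upwards [hJn] with t htJ
    simp [hW, htJ]
  have hFTC : HasDerivAt (fun u => ∫ x in t0..u, W x) (W t0) t0 :=
    intervalIntegral.integral_hasDerivAt_right hWi.intervalIntegrable
      hWi.aestronglyMeasurable.stronglyMeasurableAtFilter hWc
  have heq : (fun s => ∫ t in J, if f t ≤ s then ω t else 0) =ᶠ[𝓝 s0]
      fun s => (∫ x in t0..(b s), W x) + ∫ t in Iic t0, W t := by
    filter_upwards [hev] with s hs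
    have e1 : (∫ x in t0..(b s), W x) + ∫ t in Iic t0, W t = ∫ t in Iic (b s), W t := by
      rw [← intervalIntegral.integral_Iic_sub_Iic hWi.integrableOn hWi.integrableOn]
      ring
    rw [e1, ← integral_indicator hJm, ← integral_indicator measurableSet_Iic]
    congr 1
    funext t
    by_cases htJ : t ∈ J
    · have : f t ≤ s ↔ t ≤ b s := by
        obtain ⟨hbJ, hbs⟩ := hb s hs
        constructor
        · intro h1
          by_contra h2
          push Not at h2
          have := hmono _ hbJ _ htJ h2.le
          have := mul_pos hδ (sub_pos.2 h2)
          linarith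
        · intro h1
          have := hmono _ htJ _ hbJ h1
          have := mul_nonneg hδ.le (sub_nonneg.2 h1)
          linarith
      simp [htJ, hW, Set.indicator, this]
    · simp [htJ, hW, Set.indicator]
  have hcomp : DifferentiableAt ℝ (fun s => (∫ x in t0..(b s), W x) + ∫ t in Iic t0, W t) s0 := by
    refine DifferentiableAt.add_const _ ?_
    have h2 : HasDerivAt (fun u => ∫ x in t0..u, W x) (W t0) (b s0) := by rw [hb0]; exact hFTC
    exact (h2.comp s0 hbd).differentiableAt
  exact heq.differentiableAt_iff.2 hcomp

lemma one_d_single_anti {J : Set ℝ} (hJc : IsCompact J) {f ω : ℝ → ℝ} {s0 δ : ℝ} (hδ : 0 < δ)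
    (hf : ContinuousOn f J)
    (hmono : ∀ x ∈ J, ∀ y ∈ J, x ≤ y → δ * (y - x) ≤ f x - f y)
    (hω : IntegrableOn ω J)
    (ht : ∀ t ∈ J, f t = s0 → (J ∈ 𝓝 t ∧ ContinuousAt ω t ∧ ∃ m, m ≠ 0 ∧ HasDerivAt f m t) ∨
      ∀ᶠ x in 𝓝 t, x ∈ J → ω x = 0) :
    DifferentiableAt ℝ (fun s => ∫ t in J, if f t ≤ s then ω t else 0) s0 := by
  have hJm : MeasurableSet J := hJc.measurableSet
  have h1 := one_d_single hJc (f := fun t => - f t) (ω := ω) (s0 := -s0) hδ hf.neg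
    (fun x hx y hy hxy => by have := hmono x hx y hy hxy; linarith) hω (by
      intro t htJ h
      rcases ht t htJ (by linarith) with ⟨a, b, m, hm, h⟩ | h
      · exact Or.inl ⟨a, b, -m, by simpa using hm, h.neg⟩
      · exact Or.inr h)
  have h2 : DifferentiableAt ℝ (fun s : ℝ => (∫ t in J, ω t) -
      ∫ t in J, if - f t ≤ -s then ω t else 0) s0 :=
    (DifferentiableAt.comp s0 (f := fun s : ℝ => -s)
      (g := fun s => ∫ t in J, if - f t ≤ s then ω t else 0) h1 differentiableAt_id.neg).const_sub _
  convert h2 using 1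
  funext s
  have hcl : ∀ s, MeasurableSet (J ∩ {t | f t = s}) := by
    intro s
    exact (hf.preimage_isClosed_of_isClosed hJc.isClosed (isClosed_singleton (x := s))).measurableSet
  have hi : IntegrableOn (fun t => if - f t ≤ -s then ω t else 0) J := by
    have hm : MeasurableSet (J ∩ f ⁻¹' (Ici s)) :=
      (hf.preimage_isClosed_of_isClosed hJc.isClosed isClosed_Ici).measurableSet
    have : IntegrableOn ((J ∩ f ⁻¹' (Ici s)).indicator ω) J := hω.indicator hm
    refine this.congr_fun (fun t htJ => ?_) hJm
    simp [Set.indicator, htJ]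
  rw [← integral_sub hω hi]
  refine setIntegral_congr_ae hJm ?_
  have hnull : volume (J ∩ {t | f t = s}) = 0 := by
    refine Set.Subsingleton.measure_zero ?_ _
    rintro x ⟨hx, hx'⟩ y ⟨hy, hy'⟩
    simp only [mem_ofPred_eq] at hx' hy'
    rcases le_total x y with h | h
    · have := hmono x hx y hy h
      rw [hx', hy'] at this
      nlinarith
    · have := hmono y hy x hx h
      rw [hx', hy'] at this
      nlinarith
  have : ∀ᵐ t, t ∉ J ∩ {t | f t = s} := measure_eq_zero_iff_ae_notMem.1 hnull
  filter_upwards [this] with t htn htJ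
  have hne : f t ≠ s := fun h => htn ⟨htJ, h⟩
  rcases lt_or_gt_of_ne hne with h | h
  · simp [h.le, not_le.2 h]
  · simp [h.le, not_le.2 h]

set_option maxHeartbeats 1000000 in
lemma one_d_multi {ι : Type*} [Fintype ι] {J : Set ℝ} (hJc : IsCompact J) {f : ι → ℝ → ℝ}
    {ω : ℝ → ℝ} {l0 : ι → ℝ} {δ : ℝ} (hδ : 0 < δ)
    (hf : ∀ k, ContinuousOn (f k) J)
    (hmono : ∀ k, (∀ x ∈ J, ∀ y ∈ J, x ≤ y → δ * (y - x) ≤ f k y - f k x) ∨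
      (∀ x ∈ J, ∀ y ∈ J, x ≤ y → δ * (y - x) ≤ f k x - f k y))
    (hω : ContinuousOn ω J)
    (hco : ∀ t ∈ J, ∀ k l, k ≠ l → f k t = l0 k → f l t ≠ l0 l)
    (ht : ∀ t ∈ J, ∀ k, f k t = l0 k → (J ∈ 𝓝 t ∧ ∃ m, m ≠ 0 ∧ HasDerivAt (f k) m t) ∨
      ∀ᶠ x in 𝓝 t, x ∈ J → ω x = 0) :
    DifferentiableAt ℝ (fun lam : ι → ℝ => ∫ t in J, if ∀ k, f k t ≤ lam k then ω t else 0) l0 := by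
  have hJm : MeasurableSet J := hJc.measurableSet
  have hωi : IntegrableOn ω J := hω.integrableOn_compact hJc
  set ωk : ι → ℝ → ℝ := fun k t => if ∀ l, l ≠ k → f l t ≤ l0 l then ω t else 0 with hωk
  have hcl : ∀ (l : ι) (s : ℝ), MeasurableSet (J ∩ {t | f l t ≤ s}) := fun l s =>
    ((hf l).preimage_isClosed_of_isClosed hJc.isClosed (isClosed_Iic (a := s))).measurableSet
  have hint : ∀ (P : ℝ → Prop) [DecidablePred P] (g : ℝ → ℝ), IntegrableOn g J → MeasurableSet (J ∩ {t | P t}) →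
      IntegrableOn (fun t => if P t then g t else 0) J := by
    intro P _ g hg hP
    have : IntegrableOn ((J ∩ {t | P t}).indicator g) J := hg.indicator hP
    refine this.congr_fun (fun t htJ => ?_) hJm
    simp [Set.indicator, htJ]
  have hall : ∀ (s : ι → Prop) (lam : ι → ℝ), MeasurableSet (J ∩ {t | ∀ l, s l → f l t ≤ lam l}) := by
    intro s lam
    have : J ∩ {t | ∀ l, s l → f l t ≤ lam l} =
        J ∩ ⋂ l, ⋂ (_ : s l), (J ∩ {t | f l t ≤ lam l}) := by
      ext t
      simp only [mem_inter_iff, mem_iInter]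
      exact ⟨fun h => ⟨h.1, fun l hl => ⟨h.1, h.2 l hl⟩⟩, fun h => ⟨h.1, fun l hl => (h.2 l hl).2⟩⟩
    rw [this]
    exact hJm.inter (MeasurableSet.iInter fun l => MeasurableSet.iInter fun _ => hcl l _)
  have hωki : ∀ k, IntegrableOn (ωk k) J := fun k => hint _ _ hωi (hall (fun l => l ≠ k) l0)
  have hM : ∀ k, DifferentiableAt ℝ (fun s => ∫ t in J, if f k t ≤ s then ωk k t else 0) (l0 k) := by
    intro k
    have hcond : ∀ t ∈ J, f k t = l0 k →
        (J ∈ 𝓝 t ∧ ContinuousAt (ωk k) t ∧ ∃ m, m ≠ 0 ∧ HasDerivAt (f k) m t) ∨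
        ∀ᶠ x in 𝓝 t, x ∈ J → ωk k x = 0 := by
      intro t htJ htk
      rcases ht t htJ k htk with ⟨hJn, hm⟩ | h0
      · refine Or.inl ⟨hJn, ?_, hm⟩
        have hev : ∀ᶠ x in 𝓝 t, ∀ l, l ≠ k → (f l x ≤ l0 l ↔ f l t ≤ l0 l) := by
          rw [eventually_all]
          intro l
          by_cases hlk : l = k
          · simp [hlk]
          have hc : ContinuousAt (f l) t := (hf l).continuousAt hJn
          rcases lt_or_gt_of_ne (hco t htJ k l (Ne.symm hlk) htk) with h | h
          · filter_upwards [hc.eventually (gt_mem_nhds h)] with x hx _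
            exact iff_of_true hx.le h.le
          · filter_upwards [hc.eventually (lt_mem_nhds h)] with x hx _
            exact iff_of_false (not_le.2 hx) (not_le.2 h)
        have hc : ContinuousAt ω t := hω.continuousAt hJn
        by_cases hP : ∀ l, l ≠ k → f l t ≤ l0 l
        · refine hc.congr ?_
          filter_upwards [hev] with x hx
          have : ∀ l, l ≠ k → f l x ≤ l0 l := fun l hl => (hx l hl).2 (hP l hl)
          simp only [hωk]
          rw [if_pos this]
        · refine (continuousAt_const (y := (0:ℝ))).congr ?_
          filter_upwards [hev] with x hx
          have : ¬ ∀ l, l ≠ k → f l x ≤ l0 l := fun h => hP fun l hl => (hx l hl).1 (h l hl)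
          simp only [hωk]
          rw [if_neg this]
      · right
        filter_upwards [h0] with x hx hxJ
        simp [hωk, hx hxJ]
    rcases hmono k with h | h
    · exact one_d_single hJc hδ (hf k) h (hωki k) hcond
    · exact one_d_single_anti hJc hδ (hf k) h (hωki k) hcond
  -- separation
  have hsep : ∃ d > 0, ∀ t ∈ J, ∀ k l, k ≠ l → |f k t - l0 k| < d → d ≤ |f l t - l0 l| := by
    have hpair : ∀ k l, ∃ d > 0, k ≠ l → ∀ t ∈ J, |f k t - l0 k| < d → d ≤ |f l t - l0 l| := by
      intro k l
      by_cases hkl : k = l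
      · exact ⟨1, one_pos, fun h => absurd hkl h⟩
      rcases J.eq_empty_or_nonempty with hJe | hJne
      · exact ⟨1, one_pos, fun _ t htJ => by simp [hJe] at htJ⟩
      have hc : ContinuousOn (fun t => max |f k t - l0 k| |f l t - l0 l|) J :=
        (((hf k).sub continuousOn_const).abs).sup (((hf l).sub continuousOn_const).abs)
      obtain ⟨t0, ht0, hmin⟩ := hJc.exists_isMinOn hJne hc
      refine ⟨max |f k t0 - l0 k| |f l t0 - l0 l|, ?_, ?_⟩
      · by_cases h : f k t0 = l0 k
        · exact lt_max_of_lt_right (abs_pos.2 (sub_ne_zero.2 (hco t0 ht0 k l hkl h)))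
        · exact lt_max_of_lt_left (abs_pos.2 (sub_ne_zero.2 h))
      · intro _ t htJ hlt
        have := hmin htJ
        simp only [mem_ofPred_eq] at this
        rcases le_max_iff.1 this with h | h
        · exact absurd hlt (not_lt.2 h)
        · exact h
    choose d hd hd' using hpair
    rcases isEmpty_or_nonempty ι with hι | hι
    · exact ⟨1, one_pos, fun t _ k => hι.elim k⟩
    refine ⟨Finset.univ.inf' Finset.univ_nonempty fun p : ι × ι => d p.1 p.2, ?_, ?_⟩
    · rw [gt_iff_lt, Finset.lt_inf'_iff]
      exact fun p _ => hd _ _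
    · intro t htJ k l hkl hlt
      have h1 : (Finset.univ.inf' Finset.univ_nonempty fun p : ι × ι => d p.1 p.2) ≤ d k l :=
        Finset.inf'_le (fun p : ι × ι => d p.1 p.2) (Finset.mem_univ (k, l))
      exact h1.trans (hd' k l hkl t htJ (hlt.trans_le h1))
  obtain ⟨d, hd, hsep⟩ := hsep
  have hdiff : DifferentiableAt ℝ (fun lam : ι → ℝ =>
      (∫ t in J, if ∀ k, f k t ≤ l0 k then ω t else 0) +
      ∑ k, ((∫ t in J, if f k t ≤ lam k then ωk k t else 0) -
        ∫ t in J, if f k t ≤ l0 k then ωk k t else 0)) l0 := by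
    refine DifferentiableAt.const_add _ ?_
    refine DifferentiableAt.fun_sum fun k _ => ?_
    refine DifferentiableAt.sub_const ?_ _
    exact DifferentiableAt.comp (f := fun lam : ι → ℝ => lam k) l0 (hM k) (by fun_prop)
  refine (Filter.EventuallyEq.differentiableAt_iff ?_).2 hdiff
  filter_upwards [Metric.ball_mem_nhds l0 hd] with lam hlam
  have hi1 : ∀ k (s : ℝ), IntegrableOn (fun t => if f k t ≤ s then ωk k t else 0) J := fun k s =>
    hint _ _ (hωki k) (hcl k s)
  have hi2 : IntegrableOn (fun t => if ∀ k, f k t ≤ l0 k then ω t else 0) J :=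
    hint _ _ hωi (by simpa using hall (fun _ => True) l0)
  have e1 : ∀ k, (∫ t in J, if f k t ≤ lam k then ωk k t else 0) -
        (∫ t in J, if f k t ≤ l0 k then ωk k t else 0) =
        ∫ t in J, ((if f k t ≤ lam k then ωk k t else 0) - if f k t ≤ l0 k then ωk k t else 0) :=
    fun k => (integral_sub (hi1 k _) (hi1 k _)).symm
  simp only [e1]
  have hi3 : ∀ k ∈ (Finset.univ : Finset ι), IntegrableOn (fun t =>
      (if f k t ≤ lam k then ωk k t else 0) - if f k t ≤ l0 k then ωk k t else 0) J :=
    fun k _ => (hi1 k _).sub (hi1 k _)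
  rw [← integral_finsetSum _ hi3, ← integral_add hi2 (integrable_finsetSum _ hi3)]
  refine setIntegral_congr_fun hJm fun t htJ => ?_
  have hnear : ∀ k, |lam k - l0 k| < d := fun k => by
    have := (dist_pi_lt_iff hd).1 (Metric.mem_ball.1 hlam) k
    rwa [Real.dist_eq] at this
  have hiff : ∀ k, d ≤ |f k t - l0 k| → (f k t ≤ lam k ↔ f k t ≤ l0 k) := by
    intro k hk
    have := abs_lt.1 (hnear k)
    constructor
    · intro h2
      by_contra h3
      push Not at h3
      rw [abs_of_pos (by linarith)] at hk
      linarith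
    · intro h2
      by_contra h3
      push Not at h3
      rw [abs_of_nonpos (by linarith)] at hk
      linarith
  by_cases hk : ∃ k, |f k t - l0 k| < d
  · obtain ⟨k, hk⟩ := hk
    have hoth : ∀ l, l ≠ k → (f l t ≤ lam l ↔ f l t ≤ l0 l) := fun l hl =>
      hiff l (hsep t htJ k l (Ne.symm hl) hk)
    rw [Finset.sum_eq_single k (fun l _ hl => by simp [hoth l hl]) (by simp)]
    have hs : ∀ lam : ι → ℝ, (∀ l, f l t ≤ lam l) ↔ f k t ≤ lam k ∧ ∀ l, l ≠ k → f l t ≤ lam l := by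
      intro lam
      constructor
      · exact fun h => ⟨h k, fun l _ => h l⟩
      · rintro ⟨h1, h2⟩ l
        by_cases hl : l = k
        · rw [hl]; exact h1
        · exact h2 l hl
    have hoth' : (∀ l, l ≠ k → f l t ≤ lam l) ↔ (∀ l, l ≠ k → f l t ≤ l0 l) :=
      forall_congr' fun l => imp_congr_right fun hl => hoth l hl
    rw [if_congr (hs lam) rfl rfl, if_congr (hs l0) rfl rfl]
    simp only [hωk, hoth']
    by_cases hP : ∀ l, l ≠ k → f l t ≤ l0 l
    · simp only [and_iff_left hP, if_pos hP]; ring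
    · simp [hP]
  · push Not at hk
    have : ∀ k, (f k t ≤ lam k ↔ f k t ≤ l0 k) := fun k => hiff k (hk k)
    simp [this]

lemma one_d_multi' {ι : Type*} [Fintype ι] {J : Set ℝ} (hJc : IsCompact J) {f : ι → ℝ → ℝ}
    {ω : ℝ → ℝ} {l0 : ι → ℝ} {δ : ℝ} (hδ : 0 < δ)
    (hf : ∀ k, ContinuousOn (f k) J)
    (hmono : ∀ k, (∀ x ∈ J, ∀ y ∈ J, x ≤ y → δ * (y - x) ≤ f k y - f k x) ∨
      (∀ x ∈ J, ∀ y ∈ J, x ≤ y → δ * (y - x) ≤ f k x - f k y))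
    (hω : ContinuousOn ω J)
    (hco : ∀ t ∈ J, ∀ k l, k ≠ l → f k t = l0 k → f l t ≠ l0 l)
    (ht : ∀ t ∈ J, ∀ k, f k t = l0 k → (J ∈ 𝓝 t ∧ ∃ m, m ≠ 0 ∧ HasDerivAt (f k) m t) ∨
      ∀ᶠ x in 𝓝 t, x ∈ J → ω x = 0) :
    DifferentiableAt ℝ (fun lam : ι → ℝ => ∫ t, {t | t ∈ J ∧ ∀ k, f k t ≤ lam k}.indicator ω t)
      l0 := by
  convert one_d_multi hJc hδ hf hmono hω hco ht using 2 with lam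
  rw [← integral_indicator hJc.measurableSet]
  congr 1
  funext t
  by_cases htJ : t ∈ J <;> simp [Set.indicator, htJ]

lemma cyl_null {Xi S Z : Set (Pt n)} (hS : Convex ℝ S) (hSX : S ⊆ Xi)
    {f : Pt n → ℝ} {D : Pt n → (Pt n →L[ℝ] ℝ)}
    (hD : ∀ q ∈ Xi, HasFDerivWithinAt f (D q) Xi q) {M : ℝ} (hM : ∀ q ∈ Xi, ‖D q‖ ≤ M)
    {e : Pt n} {δ : ℝ} (hδ : 0 < δ) (hsgn : ∀ q ∈ S, δ ≤ |D q e|) {s0 : ℝ}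
    (hZS : Z ⊆ S) (hZf : ∀ q ∈ Z, f q = s0)
    (hZ : ∀ q ∈ Z, ∃ ν : Pt n →L[ℝ] ℝ, (∀ s : ℝ, ν ≠ s • D q) ∧
      ∀ η > 0, ∀ᶠ q' in 𝓝[Z] q, ν (q' - q) ≤ η * ‖q' - q‖) :
    volume {p : Pt n | ∃ t : ℝ, p + t • e ∈ Z} = 0 := by
  apply null_of_oneSided
  rintro p ⟨t, hq⟩
  set q := p + t • e with hqdef
  have hqX : q ∈ Xi := hSX (hZS hq)
  have hM0 : 0 ≤ M := (norm_nonneg _).trans (hM q hqX)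
  obtain ⟨ν, hν1, hν2⟩ := hZ q hq
  have hDe : D q e ≠ 0 := by
    intro h0
    have := hsgn q (hZS hq)
    rw [h0, abs_zero] at this
    linarith
  set a := ν e / D q e with ha
  refine ⟨ν - a • D q, sub_ne_zero.2 (hν1 a), ?_⟩
  intro η hη
  set C := 1 + M * ‖e‖ / δ with hC
  have hC1 : 1 ≤ C := by
    rw [hC]; have : 0 ≤ M * ‖e‖ / δ := by positivity
    linarith
  have hlip : ∀ (p' : Pt n) (t' : ℝ), p' + t' • e ∈ Z → ‖(p' + t' • e) - q‖ ≤ C * ‖p' - p‖ := by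
    intro p' t' hq'
    obtain ⟨z, hz, hfz⟩ := domain_mvt (fun x hx => (hD x (hSX hx)).mono hSX) hS (hZS hq) (hZS hq')
    rw [hZf _ hq, hZf _ hq', sub_self] at hfz
    have hzS : z ∈ S := hS.segment_subset (hZS hq) (hZS hq') hz
    have hdec : (p' + t' • e) - q = (p' - p) + (t' - t) • e := by rw [hqdef]; module
    rw [hdec, map_add, map_smul, smul_eq_mul] at hfz
    have h1 : |t' - t| * |D z e| = |D z (p' - p)| := by
      rw [← abs_mul, show (t' - t) * D z e = - D z (p' - p) by linarith, abs_neg]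
    have h2 : |D z (p' - p)| ≤ M * ‖p' - p‖ := by
      have := (D z).le_opNorm (p' - p)
      rw [Real.norm_eq_abs] at this
      exact this.trans (mul_le_mul_of_nonneg_right (hM z (hSX hzS)) (norm_nonneg _))
    have h3 : |t' - t| * δ ≤ M * ‖p' - p‖ := by
      refine le_trans ?_ (h1.le.trans h2)
      exact mul_le_mul_of_nonneg_left (hsgn z hzS) (abs_nonneg _)
    rw [hdec]
    calc ‖(p' - p) + (t' - t) • e‖ ≤ ‖p' - p‖ + |t' - t| * ‖e‖ := by
          refine (norm_add_le _ _).trans ?_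
          rw [norm_smul, Real.norm_eq_abs]
      _ ≤ ‖p' - p‖ + (M * ‖p' - p‖ / δ) * ‖e‖ := by
          gcongr
          rwa [le_div_iff₀ hδ]
      _ = C * ‖p' - p‖ := by rw [hC]; ring
  set η1 := η / ((1 + |a|) * C) with hη1
  have hη1p : 0 < η1 := by positivity
  have hDo : ∀ᶠ q' in 𝓝[Z] q, |D q (q' - q)| ≤ η1 * ‖q' - q‖ := by
    have h1 := ((hD q hqX).mono (hZS.trans hSX)).isLittleO.def hη1p
    filter_upwards [h1, self_mem_nhdsWithin] with q' h2 h3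
    rw [hZf _ hq, hZf _ h3, sub_self, zero_sub, norm_neg, Real.norm_eq_abs] at h2
    exact h2
  have hboth := (hν2 η1 hη1p).and hDo
  rw [eventually_nhdsWithin_iff, Metric.eventually_nhds_iff] at hboth ⊢
  obtain ⟨d, hd, hboth⟩ := hboth
  refine ⟨d / C, by positivity, ?_⟩
  rintro p' hp' ⟨t', hq'⟩
  have hl := hlip p' t' hq'
  have hdq : dist (p' + t' • e) q < d := by
    rw [dist_eq_norm] at hp' ⊢
    rw [lt_div_iff₀ (by linarith)] at hp'
    linarith
  obtain ⟨h1, h2⟩ := hboth hdq hq'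
  have hme : (ν - a • D q) e = 0 := by
    simp [ha, hDe]
  have hdec : (p' + t' • e) - q = (p' - p) + (t' - t) • e := by rw [hqdef]; module
  have h3 : (ν - a • D q) (p' - p) = (ν - a • D q) ((p' + t' • e) - q) := by
    rw [hdec, map_add, map_smul, hme]; simp
  rw [h3]
  have h4 : (ν - a • D q) ((p' + t' • e) - q) =
      ν ((p' + t' • e) - q) - a * D q ((p' + t' • e) - q) := by simp
  rw [h4]
  have h5 : -(a * D q ((p' + t' • e) - q)) ≤ |a| * (η1 * ‖(p' + t' • e) - q‖) := by
    refine (neg_le_abs _).trans ?_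
    rw [abs_mul]
    exact mul_le_mul_of_nonneg_left h2 (abs_nonneg _)
  have h6 : (1 + |a|) * η1 * ‖(p' + t' • e) - q‖ ≤ (1 + |a|) * η1 * (C * ‖p' - p‖) :=
    mul_le_mul_of_nonneg_left hl (by positivity)
  have h7 : (1 + |a|) * η1 * (C * ‖p' - p‖) = η * ‖p' - p‖ := by
    rw [hη1]
    have : (1 + |a|) ≠ 0 := by positivity
    have : C ≠ 0 := by positivity
    field_simp
  linarith

lemma exists_support {Xi : Set (Pt n)} (hc : Convex ℝ Xi) (hne : (interior Xi).Nonempty)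
    {q : Pt n} (hq : q ∉ interior Xi) :
    ∃ ν : Pt n →L[ℝ] ℝ, ν ≠ 0 ∧ ∀ q' ∈ Xi, ν (q' - q) ≤ 0 := by
  obtain ⟨ν, hν⟩ := geometric_hahn_banach_open_point hc.interior isOpen_interior hq
  refine ⟨ν, ?_, ?_⟩
  · rintro rfl
    obtain ⟨x, hx⟩ := hne
    have := hν x hx
    simp at this
  · intro q' hq'
    have h1 : q' ∈ closure (interior Xi) := by
      rw [hc.closure_interior_eq_closure_of_nonempty_interior hne]
      exact subset_closure hq'
    have h2 : closure (interior Xi) ⊆ {x | ν x ≤ ν q} :=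
      closure_minimal (fun x hx => (hν x hx).le) (isClosed_le ν.continuous continuous_const)
    have h3 : ν q' ≤ ν q := h2 h1
    rw [map_sub]; linarith

lemma fiber_integrable {h : Pt n → ℝ} (hh : Integrable h) {φ : ℝ → ℝ} (hφ : Integrable φ)
    (e : Pt n) :
    Integrable (fun z : ℝ × Pt n => φ z.1 * h (z.2 + z.1 • e)) (volume.prod volume) := by
  have hmp : MeasurePreserving (fun z : ℝ × Pt n => (z.1, z.2 + z.1 • e))
      ((volume : Measure ℝ).prod (volume : Measure (Pt n))) (volume.prod volume) := by
    refine MeasurePreserving.skew_product (f := id) (g := fun (t : ℝ) (p : Pt n) => p + t • e)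
      (MeasurePreserving.id _) ?_ ?_
    · have : Continuous (Function.uncurry fun (t : ℝ) (p : Pt n) => p + t • e) := by
        simp only [Function.uncurry_def]; fun_prop
      exact this.measurable
    · exact Eventually.of_forall fun t => map_add_right_eq_self _ _
  have := hφ.mul_prod hh
  exact hmp.integrable_comp_of_integrable this

lemma fiber_integral {h : Pt n → ℝ} (hh : Integrable h) {φ : ℝ → ℝ} (hφ : Integrable φ)
    (hφ1 : ∫ t, φ t = 1) (e : Pt n) :
    ∫ p : Pt n, ∫ t : ℝ, φ t * h (p + t • e) = ∫ q, h q := by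
  have := integral_integral_swap (f := fun (t : ℝ) (p : Pt n) => φ t * h (p + t • e))
    (μ := volume) (ν := volume) (fiber_integrable hh hφ e)
  rw [← this]
  simp_rw [integral_const_mul]
  have h2 : ∀ t : ℝ, ∫ p : Pt n, h (p + t • e) = ∫ q, h q := fun t =>
    integral_add_right_eq_self h (t • e)
  simp_rw [h2, integral_mul_const, hφ1, one_mul]

lemma closed_cell {E ι : Type*} [TopologicalSpace E] {J : Set E} (hJ : IsClosed J)
    {f : ι → E → ℝ} (hf : ∀ k, ContinuousOn (f k) J) (lam : ι → ℝ) :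
    IsClosed {t | t ∈ J ∧ ∀ k, f k t ≤ lam k} := by
  have : {t | t ∈ J ∧ ∀ k, f k t ≤ lam k} = J ∩ ⋂ k, (J ∩ f k ⁻¹' (Iic (lam k))) := by
    ext t
    simp only [Set.mem_ofPred_eq, mem_inter_iff, mem_iInter, mem_preimage, mem_Iic]
    constructor
    · rintro ⟨h1, h2⟩; exact ⟨h1, fun k => ⟨h1, h2 k⟩⟩
    · rintro ⟨h1, h2⟩; exact ⟨h1, fun k => (h2 k).2⟩
  rw [this]
  exact hJ.inter (isClosed_iInter fun k => (hf k).preimage_isClosed_of_isClosed hJ isClosed_Iic)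

lemma integrable_cell {E ι : Type*} [TopologicalSpace E] [T2Space E] [MeasurableSpace E]
    [BorelSpace E] {ν : Measure E} [IsFiniteMeasureOnCompacts ν] {J : Set E} (hJ : IsCompact J)
    {f : ι → E → ℝ} (hf : ∀ k, ContinuousOn (f k) J) {ω : E → ℝ} (hω : ContinuousOn ω J)
    (lam : ι → ℝ) :
    Integrable ({t | t ∈ J ∧ ∀ k, f k t ≤ lam k}.indicator ω) ν := by
  have hcl := closed_cell hJ.isClosed hf lam
  rw [integrable_indicator_iff hcl.measurableSet]
  exact (hω.integrableOn_compact hJ).mono_set (fun t ht => ht.1)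

lemma line_lip {ι : Type*} [Fintype ι] {J : Set ℝ} (hJc : IsCompact J) {f : ι → ℝ → ℝ}
    {ω : ℝ → ℝ} {δ B : ℝ} (hδ : 0 < δ) (hB : 0 ≤ B) (hf : ∀ k, ContinuousOn (f k) J)
    (hmono : ∀ k, (∀ x ∈ J, ∀ y ∈ J, x ≤ y → δ * (y - x) ≤ f k y - f k x) ∨
      (∀ x ∈ J, ∀ y ∈ J, x ≤ y → δ * (y - x) ≤ f k x - f k y))
    (hω : ContinuousOn ω J) (hωB : ∀ t ∈ J, |ω t| ≤ B) (lam lam' : ι → ℝ) :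
    |(∫ t, {t | t ∈ J ∧ ∀ k, f k t ≤ lam k}.indicator ω t) -
      ∫ t, {t | t ∈ J ∧ ∀ k, f k t ≤ lam' k}.indicator ω t| ≤
      B * (Fintype.card ι / δ) * ‖lam - lam'‖ := by
  rw [← integral_sub (integrable_cell hJc hf hω lam) (integrable_cell hJc hf hω lam')]
  set T : ι → Set ℝ := fun k => {t | t ∈ J ∧ min (lam k) (lam' k) ≤ f k t ∧
    f k t ≤ max (lam k) (lam' k)} with hT
  have hsep : ∀ k, ∀ x ∈ J, ∀ y ∈ J, δ * |x - y| ≤ |f k x - f k y| := by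
    intro k x hx y hy
    rcases le_total x y with hxy | hxy
    · rw [abs_sub_comm x y, abs_of_nonneg (sub_nonneg.2 hxy)]
      rcases hmono k with h | h
      · exact (h x hx y hy hxy).trans ((le_abs_self _).trans (abs_sub_comm _ _).le)
      · exact (h x hx y hy hxy).trans (le_abs_self _)
    · rw [abs_of_nonneg (sub_nonneg.2 hxy)]
      rcases hmono k with h | h
      · exact (h y hy x hx hxy).trans (le_abs_self _)
      · exact (h y hy x hx hxy).trans ((le_abs_self _).trans (abs_sub_comm _ _).le)
  have hTv : ∀ k, volume (T k) ≤ ENNReal.ofReal (‖lam - lam'‖ / δ) := by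
    intro k
    refine (Real.volume_le_diam _).trans ?_
    refine Metric.ediam_le fun x hx y hy => ?_
    rw [edist_dist]
    apply ENNReal.ofReal_le_ofReal
    rw [le_div_iff₀ hδ, Real.dist_eq]
    have h1 := hsep k x hx.1 y hy.1
    have h2 : |f k x - f k y| ≤ max (lam k) (lam' k) - min (lam k) (lam' k) := by
      rw [abs_le]; constructor <;> linarith [hx.2.1, hx.2.2, hy.2.1, hy.2.2]
    rw [max_sub_min_eq_abs] at h2
    have h3 : |lam' k - lam k| ≤ ‖lam - lam'‖ := by
      rw [abs_sub_comm]; exact norm_le_pi_norm (lam - lam') k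
    linarith
  have hTu : volume (⋃ k, T k) ≤ ENNReal.ofReal (Fintype.card ι / δ * ‖lam - lam'‖) := by
    refine (measure_iUnion_fintype_le _ _).trans ?_
    refine (Finset.sum_le_sum fun k _ => hTv k).trans ?_
    rw [Finset.sum_const, nsmul_eq_mul, Finset.card_univ,
      ← ENNReal.ofReal_natCast, ← ENNReal.ofReal_mul (by positivity)]
    apply ENNReal.ofReal_le_ofReal
    apply le_of_eq; ring
  have hzero : ∀ t, t ∉ (⋃ k, T k) → {t | t ∈ J ∧ ∀ k, f k t ≤ lam k}.indicator ω t -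
      {t | t ∈ J ∧ ∀ k, f k t ≤ lam' k}.indicator ω t = 0 := by
    intro t ht
    rw [mem_iUnion] at ht
    push Not at ht
    have : (t ∈ {t | t ∈ J ∧ ∀ k, f k t ≤ lam k}) ↔ (t ∈ {t | t ∈ J ∧ ∀ k, f k t ≤ lam' k}) := by
      simp only [Set.mem_ofPred_eq]
      refine and_congr_right fun hJ => forall_congr' fun k => ?_
      have h1 := ht k
      simp only [hT, Set.mem_ofPred_eq, not_and, not_le] at h1
      have h1 := h1 hJ
      constructor
      · intro h2
        by_contra h3
        push Not at h3
        exact absurd (h1 ((min_le_right _ _).trans h3.le)) (not_lt.2 (h2.trans (le_max_left _ _)))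
      · intro h2
        by_contra h3
        push Not at h3
        exact absurd (h1 ((min_le_left _ _).trans h3.le)) (not_lt.2 (h2.trans (le_max_right _ _)))
    by_cases h : t ∈ {t | t ∈ J ∧ ∀ k, f k t ≤ lam k}
    · rw [indicator_of_mem h, indicator_of_mem (this.1 h), sub_self]
    · rw [indicator_of_notMem h, indicator_of_notMem (fun h' => h (this.2 h')), sub_self]
  rw [← setIntegral_eq_integral_of_forall_compl_eq_zero hzero]
  have hfin : volume (⋃ k, T k) < ⊤ := hTu.trans_lt ENNReal.ofReal_lt_top
  have hbd : ∀ t ∈ (⋃ k, T k), ‖{t | t ∈ J ∧ ∀ k, f k t ≤ lam k}.indicator ω t -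
      {t | t ∈ J ∧ ∀ k, f k t ≤ lam' k}.indicator ω t‖ ≤ B := by
    intro t ht
    obtain ⟨k, hk⟩ := mem_iUnion.1 ht
    have := hωB t hk.1
    rw [Real.norm_eq_abs]
    simp only [indicator]
    split_ifs <;> simp [hB, this]
  have h := norm_setIntegral_le_of_norm_le_const hfin hbd
  rw [Real.norm_eq_abs] at h
  refine h.trans ?_
  rw [mul_assoc]
  refine mul_le_mul_of_nonneg_left ?_ hB
  exact ENNReal.toReal_le_of_le_ofReal (by positivity) hTu

lemma local_diff {ι : Type*} [Fintype ι] {Xi : Set (Pt n)} (hXc : IsCompact Xi)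
    (hcv : Convex ℝ Xi) (hint : (interior Xi).Nonempty) {q0 : Pt n} {r : ℝ} (hr : 0 < r)
    {f : ι → Pt n → ℝ} {D : ι → Pt n → (Pt n →L[ℝ] ℝ)}
    (hD : ∀ k, ∀ q ∈ Xi, HasFDerivWithinAt (f k) (D k q) Xi q)
    {M : ℝ} (hM : ∀ k, ∀ q ∈ Xi, ‖D k q‖ ≤ M) {e : Pt n} {δ : ℝ} (hδ : 0 < δ)
    (hsgn : ∀ k, (∀ q ∈ Xi ∩ closedBall q0 r, δ ≤ D k q e) ∨
      (∀ q ∈ Xi ∩ closedBall q0 r, D k q e ≤ -δ))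
    {σ : Pt n → ℝ} (hσ : ContinuousOn σ Xi) (hσ0 : ∀ q, r / 2 ≤ dist q q0 → σ q = 0)
    (l0 : ι → ℝ)
    (hpair : ∀ q ∈ Xi, ∀ k l, k ≠ l → f k q = l0 k → f l q = l0 l → ∀ s : ℝ, D l q ≠ s • D k q)
    (hbdry : ∀ q ∈ Xi, ∀ k, f k q = l0 k → ∀ ν : Pt n →L[ℝ] ℝ, ν ≠ 0 →
      (∀ q' ∈ Xi, ν (q' - q) ≤ 0) → ∀ s : ℝ, ν ≠ s • D k q) :
    DifferentiableAt ℝ (fun lam : ι → ℝ =>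
      ∫ q, {q | q ∈ Xi ∧ ∀ k, f k q ≤ lam k}.indicator σ q) l0 := by
  set S := Xi ∩ closedBall q0 r with hSdef
  have hSX : S ⊆ Xi := inter_subset_left
  have hSc : IsCompact S := hXc.inter_right isClosed_closedBall
  have hScv : Convex ℝ S := hcv.inter (convex_closedBall _ _)
  have hfc : ∀ k, ContinuousOn (f k) Xi := fun k q hq => (hD k q hq).continuousWithinAt
  -- cutoff
  let b : ContDiffBump (0 : ℝ) := ⟨1 / 2, 1, by norm_num, by norm_num⟩
  set φ : ℝ → ℝ := b.normed volume with hφ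
  have hφc : Continuous φ := b.continuous_normed
  have hφi : Integrable φ := b.integrable_normed
  have hφ1 : ∫ t, φ t = 1 := b.integral_normed
  have hφt : tsupport φ = closedBall 0 1 := b.tsupport_normed_eq
  have hφ0 : ∀ t, 1 < |t| → ∀ᶠ x in 𝓝 t, φ x = 0 := by
    intro t ht
    have : t ∉ tsupport φ := by
      rw [hφt, mem_closedBall_zero_iff, Real.norm_eq_abs]; exact not_le.2 ht
    exact notMem_tsupport_iff_eventuallyEq.1 this
  have hφ00 : ∀ t, 1 < |t| → φ t = 0 := fun t ht => (hφ0 t ht).self_of_nhds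
  obtain ⟨Bφ, hBφ⟩ : ∃ B, ∀ t, |φ t| ≤ B := by
    obtain ⟨B, hB⟩ := (isCompact_closedBall (0 : ℝ) 1).exists_bound_of_continuousOn hφc.continuousOn
    refine ⟨max B 0, fun t => ?_⟩
    by_cases ht : 1 < |t|
    · rw [hφ00 t ht]; simp
    · exact (hB t (by rw [mem_closedBall_zero_iff]; exact not_lt.1 ht)).trans (le_max_left _ _)
  obtain ⟨Bσ, hBσ⟩ := hXc.exists_bound_of_continuousOn hσ
  have hBφ0 : 0 ≤ Bφ := (abs_nonneg _).trans (hBφ 0)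
  have hBσ0 : 0 ≤ Bσ := by
    obtain ⟨x, hx⟩ := hint
    exact (norm_nonneg _).trans (hBσ x (interior_subset hx))
  -- lines
  set J : Pt n → Set ℝ := fun p => Icc (-2) 2 ∩ (fun t : ℝ => p + t • e) ⁻¹' S with hJ
  have hlc : ∀ p : Pt n, Continuous (fun t : ℝ => p + t • e) := fun p => by fun_prop
  have hJc : ∀ p, IsCompact (J p) := fun p =>
    isCompact_Icc.inter_right (hSc.isClosed.preimage (hlc p))
  have hmaps : ∀ p, MapsTo (fun t : ℝ => p + t • e) (J p) Xi := fun p t ht => hSX ht.2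
  have hfl : ∀ p k, ContinuousOn (fun t : ℝ => f k (p + t • e)) (J p) := fun p k =>
    (hfc k).comp (hlc p).continuousOn (hmaps p)
  have hωc : ∀ p, ContinuousOn (fun t : ℝ => φ t * σ (p + t • e)) (J p) := fun p =>
    hφc.continuousOn.mul (hσ.comp (hlc p).continuousOn (hmaps p))
  have hmono : ∀ p k, (∀ x ∈ J p, ∀ y ∈ J p, x ≤ y →
        δ * (y - x) ≤ f k (p + y • e) - f k (p + x • e)) ∨
      (∀ x ∈ J p, ∀ y ∈ J p, x ≤ y → δ * (y - x) ≤ f k (p + x • e) - f k (p + y • e)) := by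
    intro p k
    have key : ∀ x ∈ J p, ∀ y ∈ J p, ∃ z ∈ S,
        f k (p + y • e) - f k (p + x • e) = (y - x) * D k z e := by
      intro x hx y hy
      obtain ⟨z, hz, hfz⟩ := domain_mvt (fun q hq => (hD k q (hSX hq)).mono hSX) hScv hx.2 hy.2
      refine ⟨z, hScv.segment_subset hx.2 hy.2 hz, ?_⟩
      rw [hfz, show p + y • e - (p + x • e) = (y - x) • e by module, map_smul, smul_eq_mul]
    rcases hsgn k with h | h
    · left
      intro x hx y hy hxy
      obtain ⟨z, hz, e1⟩ := key x hx y hy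
      rw [e1, mul_comm]
      exact mul_le_mul_of_nonneg_left (h z hz) (sub_nonneg.2 hxy)
    · right
      intro x hx y hy hxy
      obtain ⟨z, hz, e1⟩ := key x hx y hy
      have := mul_le_mul_of_nonneg_left (h z hz) (sub_nonneg.2 hxy)
      linarith
  have hrew : ∀ (p : Pt n) (lam : ι → ℝ),
      (fun t : ℝ => φ t * {q | q ∈ Xi ∧ ∀ k, f k q ≤ lam k}.indicator σ (p + t • e)) =
      {t | t ∈ J p ∧ ∀ k, f k (p + t • e) ≤ lam k}.indicator (fun t => φ t * σ (p + t • e)) := by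
    intro p lam
    funext t
    by_cases h1 : 1 < |t|
    · simp [indicator, hφ00 t h1]
    by_cases h2 : r / 2 ≤ dist (p + t • e) q0
    · simp [indicator, hσ0 _ h2]
    push Not at h1 h2
    have h3 : t ∈ Icc (-2 : ℝ) 2 := by
      have := abs_le.1 h1; constructor <;> linarith
    have h4 : p + t • e ∈ closedBall q0 r := by rw [mem_closedBall]; linarith
    have h5 : t ∈ J p ↔ p + t • e ∈ Xi := by
      simp only [hJ, hSdef, mem_inter_iff, mem_preimage, h3, h4, true_and, and_true]
    simp only [indicator, Set.mem_ofPred_eq, h5]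
    split_ifs <;> simp
  set L : (ι → ℝ) → Pt n → ℝ := fun lam p =>
    ∫ t, φ t * {q | q ∈ Xi ∧ ∀ k, f k q ≤ lam k}.indicator σ (p + t • e) with hL
  have hhint : ∀ lam : ι → ℝ, Integrable ({q | q ∈ Xi ∧ ∀ k, f k q ≤ lam k}.indicator σ) volume :=
    fun lam => integrable_cell hXc hfc hσ lam
  have hLI : (fun lam : ι → ℝ => ∫ q, {q | q ∈ Xi ∧ ∀ k, f k q ≤ lam k}.indicator σ q) =
      fun lam => ∫ p, L lam p := by
    funext lam
    exact (fiber_integral (hhint lam) hφi hφ1 e).symm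
  rw [hLI]
  set bound : Pt n → ℝ := (closedBall q0 (r + 2 * ‖e‖)).indicator
    (fun _ => Bφ * Bσ * (Fintype.card ι / δ)) with hbound
  have hb0 : ∀ p, 0 ≤ bound p := fun p => indicator_nonneg (fun _ _ => by positivity) p
  refine differentiableAt_integral_of_lip (bound := bound) ?_ ?_ ?_ hb0 ?_
  · intro lam
    exact (fiber_integrable (hhint lam) hφi e).integral_prod_right
  · refine Eventually.of_forall fun p lam lam' => ?_
    simp only [hL, hrew]
    by_cases hp : p ∈ closedBall q0 (r + 2 * ‖e‖)
    · rw [hbound, indicator_of_mem hp]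
      refine line_lip (hJc p) hδ (by positivity) (hfl p) (hmono p) (hωc p) ?_ lam lam'
      intro t ht
      rw [abs_mul]
      exact mul_le_mul (hBφ t) (hBσ _ (hmaps p ht)) (abs_nonneg _) hBφ0
    · have hem : ∀ t, t ∉ J p := by
        intro t ht
        apply hp
        rw [mem_closedBall]
        have h1 : dist (p + t • e) q0 ≤ r := mem_closedBall.1 ht.2.2
        have h2 : dist p (p + t • e) ≤ 2 * ‖e‖ := by
          rw [dist_eq_norm, show p - (p + t • e) = -(t • e) by abel, norm_neg, norm_smul]
          gcongr
          rw [Real.norm_eq_abs, abs_le]; exact ht.1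
        linarith [dist_triangle p (p + t • e) q0]
      have hzero : ∀ lam : ι → ℝ, {t | t ∈ J p ∧ ∀ k, f k (p + t • e) ≤ lam k} = ∅ := by
        intro lam
        ext t; simp [hem t]
      rw [hzero, hzero, hbound, indicator_of_notMem hp]
      simp
  · rw [hbound, integrable_indicator_iff isClosed_closedBall.measurableSet]
    exact integrableOn_const (measure_closedBall_lt_top.ne)
  · -- a.e. differentiability
    have hsabs : ∀ k, ∀ q ∈ S, δ ≤ |D k q e| := by
      intro k q hq
      rcases hsgn k with h | h
      · exact (h q hq).trans (le_abs_self _)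
      · have := h q hq
        have h2 := neg_le_abs (D k q e)
        linarith
    have hbad1 : ∀ k l, k ≠ l → volume {p : Pt n | ∃ t : ℝ, p + t • e ∈
        {q | q ∈ S ∧ f k q = l0 k ∧ f l q = l0 l}} = 0 := by
      intro k l hkl
      refine cyl_null hScv hSX (hD k) (hM k) hδ (hsabs k) (s0 := l0 k) (fun q hq => hq.1)
        (fun q hq => hq.2.1) ?_
      intro q hq
      refine ⟨D l q, hpair q (hSX hq.1) k l hkl hq.2.1 hq.2.2, fun η hη => ?_⟩
      have h1 := ((hD l q (hSX hq.1)).mono (fun x hx => hSX hx.1 :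
        {q | q ∈ S ∧ f k q = l0 k ∧ f l q = l0 l} ⊆ Xi)).isLittleO.def hη
      filter_upwards [h1, self_mem_nhdsWithin] with q' h2 h3
      rw [hq.2.2, h3.2.2, sub_self, zero_sub, norm_neg] at h2
      exact (le_abs_self _).trans h2
    have hbad2 : ∀ k, volume {p : Pt n | ∃ t : ℝ, p + t • e ∈
        {q | q ∈ S ∧ q ∉ interior Xi ∧ f k q = l0 k}} = 0 := by
      intro k
      refine cyl_null hScv hSX (hD k) (hM k) hδ (hsabs k) (s0 := l0 k) (fun q hq => hq.1)
        (fun q hq => hq.2.2) ?_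
      intro q hq
      obtain ⟨ν, hν0, hν⟩ := exists_support hcv hint hq.2.1
      refine ⟨ν, hbdry q (hSX hq.1) k hq.2.2 ν hν0 hν, fun η hη => ?_⟩
      filter_upwards [self_mem_nhdsWithin] with q' h3
      exact (hν q' (hSX h3.1)).trans (by positivity)
    have hae1 : ∀ᵐ p : Pt n, ∀ k l, k ≠ l → ¬ ∃ t : ℝ, p + t • e ∈
        {q | q ∈ S ∧ f k q = l0 k ∧ f l q = l0 l} := by
      rw [ae_all_iff]; intro k
      rw [ae_all_iff]; intro l
      by_cases hkl : k = l
      · exact Eventually.of_forall fun p h => absurd hkl h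
      · have := measure_eq_zero_iff_ae_notMem.1 (hbad1 k l hkl)
        filter_upwards [this] with p hp _
        exact hp
    have hae2 : ∀ᵐ p : Pt n, ∀ k, ¬ ∃ t : ℝ, p + t • e ∈
        {q | q ∈ S ∧ q ∉ interior Xi ∧ f k q = l0 k} := by
      rw [ae_all_iff]; intro k
      exact measure_eq_zero_iff_ae_notMem.1 (hbad2 k)
    filter_upwards [hae1, hae2] with p hp1 hp2
    simp only [hL, hrew]
    refine one_d_multi' (hJc p) hδ (hfl p) (hmono p) (hωc p) ?_ ?_
    · intro t ht k l hkl hk hl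
      exact hp1 k l hkl ⟨t, ht.2, hk, hl⟩
    · intro t ht k hk
      by_cases h1 : 1 < |t|
      · right
        filter_upwards [hφ0 t h1] with x hx _
        rw [hx, zero_mul]
      by_cases h2 : r / 2 < dist (p + t • e) q0
      · right
        have : ∀ᶠ x in 𝓝 t, r / 2 < dist (p + x • e) q0 :=
          ((hlc p).dist continuous_const).continuousAt.eventually_const_lt h2
        filter_upwards [this] with x hx _
        rw [hσ0 _ hx.le, mul_zero]
      left
      push Not at h1 h2
      have hqi : p + t • e ∈ interior Xi := by
        by_contra h
        exact hp2 k ⟨t, ht.2, h, hk⟩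
      constructor
      · have a1 : Icc (-2 : ℝ) 2 ∈ 𝓝 t := by
          have := abs_le.1 h1
          exact Icc_mem_nhds (by linarith) (by linarith)
        have a2 : (fun t : ℝ => p + t • e) ⁻¹' S ∈ 𝓝 t := by
          apply (hlc p).continuousAt
          refine inter_mem (mem_interior_iff_mem_nhds.1 hqi) ?_
          exact Filter.mem_of_superset (isOpen_ball.mem_nhds (by rw [mem_ball]; linarith : p + t • e ∈ ball q0 r))
            (ball_subset_closedBall)
        exact inter_mem a1 a2
      · refine ⟨D k (p + t • e) e, ?_, ?_⟩
        · intro h0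
          have := hsabs k _ ht.2
          rw [h0, abs_zero] at this
          linarith
        · have h3 : HasFDerivAt (f k) (D k (p + t • e)) (p + t • e) :=
            (hD k _ (hSX ht.2)).hasFDerivAt (mem_interior_iff_mem_nhds.1 hqi)
          have h4 : HasDerivAt (fun t : ℝ => p + t • e) e t := by
            simpa using ((hasDerivAt_id t).smul_const e).const_add p
          exact h3.comp_hasDerivAt t h4

lemma vel_nonpos {K X : Set (Pt n)} {E : Pt n → Pt n} {DE : Pt n →L[ℝ] Pt n} {p r x : Pt n}
    (hK : Convex ℝ K) (hp : p ∈ K) (hr : r ∈ K) (hE : HasFDerivWithinAt E DE K p)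
    (hmaps : MapsTo E K X) (hx : E p = x) {u : Pt n → ℝ} {a : Pt n →L[ℝ] ℝ}
    (hu : HasFDerivWithinAt u a X x) (hle : ∀ y ∈ segment ℝ p r, u (E y) ≤ u x) :
    a (DE (r - p)) ≤ 0 := by
  subst hx
  have hsub : segment ℝ p r ⊆ K := hK.segment_subset hp hr
  have h1 : HasFDerivWithinAt (u ∘ E) (a.comp DE) (segment ℝ p r) p :=
    (hu.comp p hE hmaps).mono hsub
  have h2 : IsLocalMaxOn (u ∘ E) (segment ℝ p r) p := by
    have : IsMaxOn (u ∘ E) (segment ℝ p r) p := fun y hy => hle y hy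
    exact this.localize
  have h3 := h2.hasFDerivWithinAt_nonpos h1
    (sub_mem_posTangentConeAt_of_segment_subset subset_rfl)
  exact h3

lemma choose_r {K R : Set (Pt n)} {E : Pt n → Pt n}
    (hE : DifferentiableOn ℝ E K) (hR : R ⊆ E '' K) (hvol : volume R ≠ 0)
    (p : Pt n) {m : Pt n →L[ℝ] ℝ} (hm : m ≠ 0) : ∃ r ∈ K, E r ∈ R ∧ m (r - p) ≠ 0 := by
  by_contra hcon
  push Not at hcon
  apply hvol
  have h0 : volume (K ∩ E ⁻¹' R) = 0 := by
    apply null_of_oneSided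
    intro y hy
    refine ⟨m, hm, fun η hη => ?_⟩
    filter_upwards [self_mem_nhdsWithin] with y' hy'
    have e1 := hcon y hy.1 hy.2
    have e2 := hcon y' hy'.1 hy'.2
    rw [map_sub] at e1 e2
    rw [map_sub, show m y' - m y = 0 by linarith]
    positivity
  have h1 : R ⊆ E '' (K ∩ E ⁻¹' R) := by
    intro y hy
    obtain ⟨z, hz, rfl⟩ := hR hy
    exact ⟨z, ⟨hz, hy⟩, rfl⟩
  refine measure_mono_null h1 ?_
  exact addHaar_image_eq_zero_of_differentiableOn_of_addHaar_eq_zero _ (hE.mono inter_subset_left) h0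

lemma chart_int {K X : Set (Pt n)} {E : Pt n → Pt n} (hK : Convex ℝ K) (hKc : IsCompact K)
    (hE : DifferentiableOn ℝ E K) (hbij : E '' K = X) (hX : volume X ≠ 0) :
    (interior K).Nonempty := by
  by_contra h
  rw [not_nonempty_iff_eq_empty] at h
  apply hX
  rw [← hbij]
  refine addHaar_image_eq_zero_of_differentiableOn_of_addHaar_eq_zero _ hE ?_
  have := hK.addHaar_frontier volume
  rwa [frontier, h, sdiff_empty, hKc.isClosed.closure_eq] at this

lemma chart_inv {K X : Set (Pt n)} {E I : Pt n → Pt n} (hK : UniqueDiffOn ℝ K)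
    (hE : DifferentiableOn ℝ E K) (hI : DifferentiableOn ℝ I X) (hmaps : MapsTo E K X)
    (hinv : LeftInvOn I E K) {q : Pt n} (hq : q ∈ K) :
    (fderivWithin ℝ I X (E q)).comp (fderivWithin ℝ E K q) = ContinuousLinearMap.id ℝ _ ∧
    (fderivWithin ℝ E K q).comp (fderivWithin ℝ I X (E q)) = ContinuousLinearMap.id ℝ _ := by
  have h1 : HasFDerivWithinAt (I ∘ E)
      ((fderivWithin ℝ I X (E q)).comp (fderivWithin ℝ E K q)) K q :=
    (hI _ (hmaps hq)).hasFDerivWithinAt.comp q (hE q hq).hasFDerivWithinAt hmaps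
  have h2 : HasFDerivWithinAt (I ∘ E) (ContinuousLinearMap.id ℝ _) K q :=
    (hasFDerivWithinAt_id q K).congr (fun y hy => hinv hy) (hinv hq)
  have h3 := (hK q hq).eq h1 h2
  refine ⟨h3, ?_⟩
  have h4 : (fderivWithin ℝ I X (E q)).toLinearMap * (fderivWithin ℝ E K q).toLinearMap = 1 := by
    ext1 v
    exact DFunLike.congr_fun h3 v
  have h5 := mul_eq_one_comm.1 h4
  ext1 v
  exact DFunLike.congr_fun h5 v

lemma lag_iff {X : Set (Pt n)} {c : Pt n → Fin N → ℝ} {ψ : Fin N → ℝ} {i : Fin N} {x : Pt n} :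
    x ∈ LagCell X c ψ i ↔ x ∈ X ∧ ∀ k, -c x k + c x i ≤ ψ k - ψ i := by
  have : Nonempty (Fin N) := ⟨i⟩
  have hb : BddAbove (range fun j => -c x j - ψ j) := (finite_range _).bddAbove
  simp only [LagCell, Set.mem_ofPred_eq]
  refine and_congr_right fun _ => ?_
  constructor
  · intro h k
    have := le_ciSup hb k
    rw [← h] at this
    linarith
  · intro h
    apply le_antisymm
    · exact le_ciSup hb i
    · exact ciSup_le fun k => by linarith [h k]

lemma velo {X K : Set (Pt n)} {c : Pt n → Fin N → ℝ} {ψ : Fin N → ℝ} {j : Fin N}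
    {E I : Pt n → Pt n}
    (hreg : RegCond X c) (hK : Convex ℝ K) (hKu : UniqueDiffOn ℝ K)
    (hE : DifferentiableOn ℝ E K) (hI : DifferentiableOn ℝ I X)
    (hbij : BijOn E K X) (hinv : InvOn I E K X)
    (hqc : ∀ (t : ℝ) (k : Fin N), Convex ℝ {p ∈ K | -c (E p) k + c (E p) j ≤ t})
    (hvol : volume (LagCell X c ψ j) ≠ 0) {x : Pt n} (hx : x ∈ X)
    {ℓ : Pt n →L[ℝ] ℝ} (hℓ : ℓ ≠ 0) :
    ∃ v, ℓ v ≠ 0 ∧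
      (∀ m, -c x m + c x j = ψ m - ψ j →
        fderivWithin ℝ (fun y => c y j) X x v ≤ fderivWithin ℝ (fun y => c y m) X x v) ∧
      (∀ (F : Pt n → ℝ) (a : Pt n →L[ℝ] ℝ), HasFDerivWithinAt F a X x →
        (∀ y ∈ X, F y ≤ F x) → a v ≤ 0) := by
  set p := I x with hp
  have hEp : E p = x := hinv.2 hx
  have hpK : p ∈ K := by
    obtain ⟨z, hz, hzx⟩ := hbij.surjOn hx
    rw [hp, ← hzx, hinv.1 hz]; exact hz
  obtain ⟨hc1, hc2⟩ := chart_inv hKu hE hI hbij.mapsTo hinv.1 hpK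
  have hm : ℓ.comp (fderivWithin ℝ E K p) ≠ 0 := by
    intro h0
    apply hℓ
    have : (ℓ.comp (fderivWithin ℝ E K p)).comp (fderivWithin ℝ I X (E p)) = 0 := by
      rw [h0]; simp
    rw [ContinuousLinearMap.comp_assoc, hc2, ContinuousLinearMap.comp_id] at this
    exact this
  obtain ⟨r, hrK, hrL, hr⟩ := choose_r hE
    (R := LagCell X c ψ j) (by rw [hbij.image_eq]; exact fun y hy => (lag_iff.1 hy).1) hvol p hm
  have hEd := (hE p hpK).hasFDerivWithinAt
  refine ⟨fderivWithin ℝ E K p (r - p), hr, ?_, ?_⟩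
  · intro m hxm
    have hu : HasFDerivWithinAt (fun y => -c y m + c y j)
        (-fderivWithin ℝ (fun y => c y m) X x + fderivWithin ℝ (fun y => c y j) X x) X x :=
      ((((hreg m).differentiableOn (by norm_num)) x hx).hasFDerivWithinAt.neg).add
        (((hreg j).differentiableOn (by norm_num)) x hx).hasFDerivWithinAt
    have h := vel_nonpos hK hpK hrK hEd hbij.mapsTo hEp hu ?_
    · simp only [add_apply, neg_apply] at h
      linarith
    · intro y hy
      have h1 : p ∈ {p ∈ K | -c (E p) m + c (E p) j ≤ ψ m - ψ j} := by
        refine ⟨hpK, ?_⟩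
        rw [hEp]; exact hxm.le
      have h2 : r ∈ {p ∈ K | -c (E p) m + c (E p) j ≤ ψ m - ψ j} :=
        ⟨hrK, (lag_iff.1 hrL).2 m⟩
      have h3 := ((hqc (ψ m - ψ j) m).segment_subset h1 h2 hy).2
      rw [hxm]; exact h3
  · intro F a hF hmax
    refine vel_nonpos hK hpK hrK hEd hbij.mapsTo hEp hF ?_
    intro y hy
    exact hmax _ (hbij.mapsTo (hK.segment_subset hpK hrK hy))

structure ChartOK (X : Set (Pt n)) (c : Pt n → Fin N → ℝ) (j : Fin N) (K : Set (Pt n))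
    (E I : Pt n → Pt n) : Prop where
  cv : Convex ℝ K
  cpt : IsCompact K
  int : (interior K).Nonempty
  hE : ContDiffOn ℝ 2 E K
  hI : ContDiffOn ℝ 2 I X
  bij : BijOn E K X
  inv : InvOn I E K X
  qc : ∀ (t : ℝ) (k : Fin N), Convex ℝ {p ∈ K | -c (E p) k + c (E p) j ≤ t}

lemma ChartOK.ud {X : Set (Pt n)} {c : Pt n → Fin N → ℝ} {j : Fin N} {K : Set (Pt n)}
    {E I : Pt n → Pt n} (h : ChartOK X c j K E I) : UniqueDiffOn ℝ K :=
  uniqueDiffOn_convex h.cv h.int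

def fch (c : Pt n → Fin N → ℝ) (i : Fin N) (E : Pt n → Pt n) (k : Fin N) (p : Pt n) : ℝ :=
  -c (E p) k + c (E p) i

def bch (X : Set (Pt n)) (c : Pt n → Fin N → ℝ) (k : Fin N) (x : Pt n) : Pt n →L[ℝ] ℝ :=
  fderivWithin ℝ (fun y => c y k) X x

def Dch (X : Set (Pt n)) (c : Pt n → Fin N → ℝ) (i : Fin N) (K : Set (Pt n)) (E : Pt n → Pt n)
    (k : Fin N) (q : Pt n) : Pt n →L[ℝ] ℝ :=
  (bch X c i (E q) - bch X c k (E q)).comp (fderivWithin ℝ E K q)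

lemma ChartOK.hasD {X : Set (Pt n)} {c : Pt n → Fin N → ℝ} {i : Fin N} {K : Set (Pt n)}
    {E I : Pt n → Pt n} (h : ChartOK X c i K E I) (hreg : RegCond X c) (k : Fin N)
    {q : Pt n} (hq : q ∈ K) :
    HasFDerivWithinAt (fch c i E k) (Dch X c i K E k q) K q := by
  have hx := h.bij.mapsTo hq
  have hu : HasFDerivWithinAt (fun y => -c y k + c y i)
      (-bch X c k (E q) + bch X c i (E q)) X (E q) :=
    ((((hreg k).differentiableOn (by norm_num)) _ hx).hasFDerivWithinAt.neg).add
      (((hreg i).differentiableOn (by norm_num)) _ hx).hasFDerivWithinAt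
  have hE := ((h.hE.differentiableOn (by norm_num)) q hq).hasFDerivWithinAt
  have := hu.comp q hE h.bij.mapsTo
  rw [Dch, sub_eq_neg_add]
  exact this

lemma ChartOK.contD {X : Set (Pt n)} {c : Pt n → Fin N → ℝ} {i : Fin N} {K : Set (Pt n)}
    {E I : Pt n → Pt n} (h : ChartOK X c i K E I) (hreg : RegCond X c) (k : Fin N) :
    ContinuousOn (Dch X c i K E k) K := by
  have h1 : ContDiffOn ℝ 2 (fch c i E k) K := by
    have a1 := (hreg k).comp h.hE h.bij.mapsTo
    have a2 := (hreg i).comp h.hE h.bij.mapsTo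
    exact a1.neg.add a2
  refine (h1.continuousOn_fderivWithin h.ud (by norm_num)).congr ?_
  intro q hq
  exact ((h.hasD hreg k hq).fderivWithin (h.ud q hq)).symm

lemma ChartOK.D_comp {X : Set (Pt n)} {c : Pt n → Fin N → ℝ} {i : Fin N} {K : Set (Pt n)}
    {E I : Pt n → Pt n} (h : ChartOK X c i K E I) (k : Fin N)
    {q : Pt n} (hq : q ∈ K) :
    (Dch X c i K E k q).comp (fderivWithin ℝ I X (E q)) = bch X c i (E q) - bch X c k (E q) := by
  obtain ⟨_, h2⟩ := chart_inv h.ud (h.hE.differentiableOn (by norm_num))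
    (h.hI.differentiableOn (by norm_num)) h.bij.mapsTo h.inv.1 hq
  rw [Dch, ContinuousLinearMap.comp_assoc, h2, ContinuousLinearMap.comp_id]

lemma ChartOK.velo {X : Set (Pt n)} {c : Pt n → Fin N → ℝ} {j : Fin N} {K : Set (Pt n)}
    {E I : Pt n → Pt n} (h : ChartOK X c j K E I) (hreg : RegCond X c) {ψ : Fin N → ℝ}
    (hvol : volume (LagCell X c ψ j) ≠ 0) {x : Pt n} (hx : x ∈ X)
    {ℓ : Pt n →L[ℝ] ℝ} (hℓ : ℓ ≠ 0) :
    ∃ v, ℓ v ≠ 0 ∧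
      (∀ m, -c x m + c x j = ψ m - ψ j → bch X c j x v ≤ bch X c m x v) ∧
      (∀ (F : Pt n → ℝ) (a : Pt n →L[ℝ] ℝ), HasFDerivWithinAt F a X x →
        (∀ y ∈ X, F y ≤ F x) → a v ≤ 0) :=
  _root_.velo hreg h.cv h.ud (h.hE.differentiableOn (by norm_num))
    (h.hI.differentiableOn (by norm_num)) h.bij h.inv h.qc hvol hx hℓ

lemma chart_pair {X : Set (Pt n)} {c : Pt n → Fin N → ℝ} {K : Fin N → Set (Pt n)}
    {E I : Fin N → Pt n → Pt n} (h : ∀ i, ChartOK X c i (K i) (E i) (I i)) (hreg : RegCond X c)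
    (htw : TwistCond X c) {ψ : Fin N → ℝ} (hvol : ∀ j, volume (LagCell X c ψ j) ≠ 0)
    {i k l : Fin N} (hki : k ≠ i) (hli : l ≠ i) (hkl : k ≠ l) {q : Pt n} (hq : q ∈ K i)
    (hk : fch c i (E i) k q = ψ k - ψ i) (hl : fch c i (E i) l q = ψ l - ψ i) (s : ℝ) :
    Dch X c i (K i) (E i) l q ≠ s • Dch X c i (K i) (E i) k q := by
  intro heq
  have hx := (h i).bij.mapsTo hq
  have e1 : bch X c i (E i q) - bch X c l (E i q) =
      s • (bch X c i (E i q) - bch X c k (E i q)) := by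
    rw [← (h i).D_comp l hq, ← (h i).D_comp k hq, heq, ContinuousLinearMap.smul_comp]
  simp only [fch] at hk hl
  generalize hxd : E i q = x at *
  have hℓ : bch X c i x - bch X c k x ≠ 0 := sub_ne_zero.2 (htw x hx i k hki.symm)
  have e2 : ∀ v, bch X c i x v - bch X c l x v = s * (bch X c i x v - bch X c k x v) := by
    intro v
    have := DFunLike.congr_fun e1 v
    simpa using this
  have hvx : ∀ j, ∃ v, bch X c i x v - bch X c k x v ≠ 0 ∧
      (∀ m, -c x m + c x j = ψ m - ψ j → bch X c j x v ≤ bch X c m x v) := by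
    intro j
    obtain ⟨v, h1, h2, _⟩ := (h j).velo hreg (hvol j) hx hℓ
    exact ⟨v, by simpa using h1, h2⟩
  rcases lt_trichotomy s 0 with hs | hs | hs
  · obtain ⟨v, h1, h2⟩ := hvx i
    have a1 := h2 k hk
    have a2 := h2 l hl
    have a3 := e2 v
    have a4 : bch X c i x v - bch X c k x v < 0 := lt_of_le_of_ne (by linarith) h1
    have := mul_pos_of_neg_of_neg hs a4
    linarith
  · rw [hs, zero_smul] at e1
    exact htw x hx i l hli.symm (sub_eq_zero.1 e1)
  rcases lt_trichotomy s 1 with hs1 | hs1 | hs1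
  · obtain ⟨v, h1, h2⟩ := hvx l
    have a1 := h2 i (by linarith)
    have a2 := h2 k (by linarith)
    have a3 := e2 v
    have a4 : 0 < bch X c i x v - bch X c k x v := by
      refine lt_of_le_of_ne ?_ h1.symm
      by_contra hc
      push Not at hc
      have := mul_neg_of_pos_of_neg hs hc
      linarith
    nlinarith
  · rw [hs1, one_smul] at e1
    exact htw x hx l k hkl.symm (sub_right_injective e1)
  · obtain ⟨v, h1, h2⟩ := hvx k
    have a1 := h2 i (by linarith)
    have a2 := h2 l (by linarith)
    have a3 := e2 v
    have a4 : 0 < bch X c i x v - bch X c k x v := lt_of_le_of_ne (by linarith) h1.symm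
    nlinarith

lemma chart_bdry {X : Set (Pt n)} {c : Pt n → Fin N → ℝ} {K : Fin N → Set (Pt n)}
    {E I : Fin N → Pt n → Pt n} (h : ∀ i, ChartOK X c i (K i) (E i) (I i)) (hreg : RegCond X c)
    (htw : TwistCond X c) {ψ : Fin N → ℝ} (hvol : ∀ j, volume (LagCell X c ψ j) ≠ 0)
    {i k : Fin N} (hki : k ≠ i) {q : Pt n} (hq : q ∈ K i)
    (hk : fch c i (E i) k q = ψ k - ψ i) {ν : Pt n →L[ℝ] ℝ} (hν0 : ν ≠ 0)
    (hν : ∀ q' ∈ K i, ν (q' - q) ≤ 0) (s : ℝ) :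
    ν ≠ s • Dch X c i (K i) (E i) k q := by
  intro heq
  have hx := (h i).bij.mapsTo hq
  have e1 : ν.comp (fderivWithin ℝ (I i) X (E i q)) =
      s • (bch X c i (E i q) - bch X c k (E i q)) := by
    rw [← (h i).D_comp k hq, heq, ContinuousLinearMap.smul_comp]
  have hs0 : s ≠ 0 := by
    rintro rfl
    rw [zero_smul] at heq
    exact hν0 heq
  have hF : HasFDerivWithinAt (fun y => ν (I i y))
      (s • (bch X c i (E i q) - bch X c k (E i q))) X (E i q) := by
    rw [← e1]
    exact ν.hasFDerivAt.comp_hasFDerivWithinAt _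
      (((h i).hI.differentiableOn (by norm_num)) _ hx).hasFDerivWithinAt
  have hFm : ∀ y ∈ X, ν (I i y) ≤ ν (I i (E i q)) := by
    intro y hy
    obtain ⟨z, hz, rfl⟩ := (h i).bij.surjOn hy
    rw [(h i).inv.1 hz, (h i).inv.1 hq]
    have := hν z hz
    rw [map_sub] at this
    linarith
  simp only [fch] at hk
  generalize hxd : E i q = x at *
  have hℓ : bch X c i x - bch X c k x ≠ 0 := sub_ne_zero.2 (htw x hx i k hki.symm)
  have hvx : ∀ j, ∃ v, bch X c i x v - bch X c k x v ≠ 0 ∧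
      (∀ m, -c x m + c x j = ψ m - ψ j → bch X c j x v ≤ bch X c m x v) ∧
      s * (bch X c i x v - bch X c k x v) ≤ 0 := by
    intro j
    obtain ⟨v, h1, h2, h3⟩ := (h j).velo hreg (hvol j) hx hℓ
    have := h3 _ _ hF hFm
    exact ⟨v, by simpa using h1, h2, by simpa using this⟩
  rcases lt_or_gt_of_ne hs0 with hs | hs
  · obtain ⟨v, h1, h2, h3⟩ := hvx i
    have a1 := h2 k hk
    have a4 : bch X c i x v - bch X c k x v < 0 := lt_of_le_of_ne (by linarith) h1
    have := mul_pos_of_neg_of_neg hs a4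
    linarith
  · obtain ⟨v, h1, h2, h3⟩ := hvx k
    have a1 := h2 i (by linarith)
    have a4 : 0 < bch X c i x v - bch X c k x v := lt_of_le_of_ne (by linarith) h1.symm
    have := mul_pos hs a4
    linarith

lemma global_diff {ι : Type*} [Fintype ι] {Xi : Set (Pt n)} (hXc : IsCompact Xi)
    (hcv : Convex ℝ Xi) (hint : (interior Xi).Nonempty)
    {f : ι → Pt n → ℝ} {D : ι → Pt n → (Pt n →L[ℝ] ℝ)}
    (hD : ∀ k, ∀ q ∈ Xi, HasFDerivWithinAt (f k) (D k q) Xi q)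
    (hDc : ∀ k, ContinuousOn (D k) Xi) (hD0 : ∀ k, ∀ q ∈ Xi, D k q ≠ 0)
    {σ : Pt n → ℝ} (hσ : ContinuousOn σ Xi)
    (l0 : ι → ℝ)
    (hpair : ∀ q ∈ Xi, ∀ k l, k ≠ l → f k q = l0 k → f l q = l0 l → ∀ s : ℝ, D l q ≠ s • D k q)
    (hbdry : ∀ q ∈ Xi, ∀ k, f k q = l0 k → ∀ ν : Pt n →L[ℝ] ℝ, ν ≠ 0 →
      (∀ q' ∈ Xi, ν (q' - q) ≤ 0) → ∀ s : ℝ, ν ≠ s • D k q) :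
    DifferentiableAt ℝ (fun lam : ι → ℝ =>
      ∫ q, {q | q ∈ Xi ∧ ∀ k, f k q ≤ lam k}.indicator σ q) l0 := by
  have hfc : ∀ k, ContinuousOn (f k) Xi := fun k q hq => (hD k q hq).continuousWithinAt
  obtain ⟨M, hM⟩ : ∃ M, ∀ k, ∀ q ∈ Xi, ‖D k q‖ ≤ M := by
    choose B hB using fun k => hXc.exists_bound_of_continuousOn (hDc k)
    obtain ⟨M, hM⟩ := (finite_range B).bddAbove
    exact ⟨M, fun k q hq => (hB k q hq).trans (hM (mem_range_self k))⟩
  have hloc : ∀ q0 : Pt n, ∃ r > 0, q0 ∈ Xi → ∃ (e : Pt n) (δ : ℝ), 0 < δ ∧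
      ∀ k, (∀ q ∈ Xi ∩ closedBall q0 r, δ ≤ D k q e) ∨
      (∀ q ∈ Xi ∩ closedBall q0 r, D k q e ≤ -δ) := by
    intro q0
    by_cases hq0 : q0 ∈ Xi
    swap
    · exact ⟨1, one_pos, fun h => absurd h hq0⟩
    obtain ⟨e, he⟩ : ∃ e : Pt n, ∀ k, D k q0 e ≠ 0 := by
      refine Module.Dual.exists_forall_ne_zero_of_forall_exists
        (fun k => (D k q0).toLinearMap) ?_
      intro k
      by_contra hcon
      push Not at hcon
      exact hD0 k q0 hq0 (ContinuousLinearMap.ext hcon)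
    have h1 : ∀ᶠ δ in 𝓝[>] (0 : ℝ), ∀ k, δ ≤ |D k q0 e| / 2 := by
      rw [eventually_all]
      intro k
      have : 0 < |D k q0 e| / 2 := by have := abs_pos.2 (he k); linarith
      filter_upwards [Ioc_mem_nhdsGT this] with d hd using hd.2
    obtain ⟨δ, hδ, hδ0⟩ := (h1.and self_mem_nhdsWithin).exists
    have hδ0 : 0 < δ := hδ0
    have h2 : ∀ᶠ q in 𝓝[Xi] q0, ∀ k, |D k q e - D k q0 e| < δ := by
      rw [eventually_all]
      intro k
      have hc : ContinuousWithinAt (fun q => D k q e) Xi q0 :=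
        (hDc k q0 hq0).clm_apply continuousWithinAt_const
      have := Metric.tendsto_nhds.1 hc δ hδ0
      simpa only [Real.dist_eq] using this
    obtain ⟨r, hr, hr2⟩ := Metric.mem_nhdsWithin_iff.1 h2
    refine ⟨r / 2, by positivity, fun _ => ⟨e, δ, hδ0, fun k => ?_⟩⟩
    have h3 : ∀ q ∈ Xi ∩ closedBall q0 (r / 2), |D k q e - D k q0 e| < δ := by
      intro q hq
      refine hr2 ⟨?_, hq.1⟩ k
      have := mem_closedBall.1 hq.2
      rw [mem_ball]; linarith
    rcases lt_or_gt_of_ne (he k) with hk | hk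
    · right
      intro q hq
      have a1 := (abs_lt.1 (h3 q hq)).2
      have a2 := hδ k
      rw [abs_of_neg hk] at a2
      linarith
    · left
      intro q hq
      have a1 := (abs_lt.1 (h3 q hq)).1
      have a2 := hδ k
      rw [abs_of_pos hk] at a2
      linarith
  choose r hr hloc using hloc
  obtain ⟨T, hTX, hT⟩ := hXc.elim_nhds_subcover (fun q => ball q (r q / 2))
    (fun q _ => ball_mem_nhds q (by have := hr q; positivity))
  set χ : Pt n → Pt n → ℝ := fun m q => max (r m / 2 - dist q m) 0 with hχ
  have hχc : ∀ m, Continuous (χ m) := fun m => by fun_prop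
  have hχ0 : ∀ m q, 0 ≤ χ m q := fun m q => le_max_right _ _
  have hΧ : ∀ q ∈ Xi, 0 < ∑ m ∈ T, χ m q := by
    intro q hq
    obtain ⟨m, hm, hqm⟩ := mem_iUnion₂.1 (hT hq)
    refine Finset.sum_pos' (fun m _ => hχ0 m q) ⟨m, hm, ?_⟩
    rw [mem_ball] at hqm
    exact lt_max_of_lt_left (by linarith)
  set τ : Pt n → Pt n → ℝ := fun m q => σ q * χ m q / ∑ m ∈ T, χ m q with hτ
  have hτc : ∀ m, ContinuousOn (τ m) Xi := by
    intro m
    refine (hσ.mul (hχc m).continuousOn).div ?_ (fun q hq => (hΧ q hq).ne')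
    exact (continuous_finsetSum _ fun m _ => hχc m).continuousOn
  have hsum : ∀ q ∈ Xi, σ q = ∑ m ∈ T, τ m q := by
    intro q hq
    simp only [hτ]
    rw [← Finset.sum_div, ← Finset.mul_sum, mul_div_assoc, div_self (hΧ q hq).ne', mul_one]
  have hrew : (fun lam : ι → ℝ => ∫ q, {q | q ∈ Xi ∧ ∀ k, f k q ≤ lam k}.indicator σ q) =
      fun lam => ∑ m ∈ T, ∫ q, {q | q ∈ Xi ∧ ∀ k, f k q ≤ lam k}.indicator (τ m) q := by
    funext lam
    rw [← integral_finsetSum _ (fun m _ => integrable_cell hXc hfc (hτc m) lam)]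
    congr 1
    funext q
    by_cases hq : q ∈ {q | q ∈ Xi ∧ ∀ k, f k q ≤ lam k}
    · simp only [indicator_of_mem hq]
      exact hsum q hq.1
    · simp only [indicator_of_notMem hq, Finset.sum_const_zero]
  rw [hrew]
  refine DifferentiableAt.fun_sum fun m hm => ?_
  obtain ⟨e, δ, hδ, hsgn⟩ := hloc m (hTX m hm)
  refine local_diff hXc hcv hint (hr m) hD hM hδ hsgn (hτc m) ?_ l0 hpair hbdry
  intro q hq
  have : χ m q = 0 := max_eq_right (by linarith)
  simp [hτ, this]

lemma G_formula {X : Set (Pt n)} {c : Pt n → Fin N → ℝ} {i : Fin N} {K : Set (Pt n)}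
    {E I : Pt n → Pt n} (h : ChartOK X c i K E I) (hreg : RegCond X c) {μ : Measure (Pt n)}
    {ρ : Pt n → ℝ} (hμ : μ = volume.withDensity (fun x => ENNReal.ofReal (ρ x)))
    (hρ : ContinuousOn ρ X) :
    ∃ σ : Pt n → ℝ, ContinuousOn σ K ∧ ∀ ψ : Fin N → ℝ, Gfun X c μ ψ i =
      ∫ q, {q | q ∈ K ∧ ∀ k : {k // k ≠ i}, fch c i E k q ≤ ψ k - ψ i}.indicator σ q := by
  refine ⟨fun q => |(fderivWithin ℝ E K q).det| * max (ρ (E q)) 0, ?_, ?_⟩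
  · refine ContinuousOn.mul ?_ ?_
    · have h1 := h.hE.continuousOn_fderivWithin h.ud (by norm_num)
      exact (ContinuousLinearMap.continuous_det.comp_continuousOn h1).abs
    · exact ContinuousOn.sup (hρ.comp h.hE.continuousOn h.bij.mapsTo) continuousOn_const
  intro ψ
  have hfc : ∀ k : {k // k ≠ i}, ContinuousOn (fch c i E k) K := fun k q hq =>
    (h.hasD hreg k hq).continuousWithinAt
  have hcl := closed_cell h.cpt.isClosed hfc (fun k => ψ k - ψ i)
  set R := {q | q ∈ K ∧ ∀ k : {k // k ≠ i}, fch c i E k q ≤ ψ k - ψ i} with hR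
  have hRK : R ⊆ K := fun q hq => hq.1
  have himg : LagCell X c ψ i = E '' R := by
    ext x
    rw [lag_iff]
    constructor
    · rintro ⟨hx, h1⟩
      obtain ⟨z, hz, rfl⟩ := h.bij.surjOn hx
      exact ⟨z, ⟨hz, fun k => h1 k⟩, rfl⟩
    · rintro ⟨z, ⟨hz, h1⟩, rfl⟩
      refine ⟨h.bij.mapsTo hz, fun k => ?_⟩
      by_cases hk : k = i
      · subst hk; simp
      · exact h1 ⟨k, hk⟩
  rw [Gfun, himg, hμ, withDensity_apply' _ _, lintegral_image_eq_lintegral_abs_det_fderiv_mul volume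
    hcl.measurableSet (fun q hq => (((h.hE.differentiableOn (by norm_num)) q
      (hRK hq)).hasFDerivWithinAt).mono hRK) (h.bij.injOn.mono hRK), integral_indicator
      hcl.measurableSet, integral_eq_lintegral_of_nonneg_ae]
  · congr 1
    refine lintegral_congr fun q => ?_
    rw [ENNReal.ofReal_mul (abs_nonneg _), ENNReal.ofReal_max]
    simp
  · exact Eventually.of_forall fun q => by positivity
  · refine ContinuousOn.aestronglyMeasurable ?_ hcl.measurableSet
    refine ContinuousOn.mono ?_ hRK
    refine ContinuousOn.mul ?_ ?_
    · have h1 := h.hE.continuousOn_fderivWithin h.ud (by norm_num)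
      exact (ContinuousLinearMap.continuous_det.comp_continuousOn h1).abs
    · exact ContinuousOn.sup (hρ.comp h.hE.continuousOn h.bij.mapsTo) continuousOn_const

lemma G_diff {X : Set (Pt n)} {c : Pt n → Fin N → ℝ} {K : Fin N → Set (Pt n)}
    {E I : Fin N → Pt n → Pt n} (h : ∀ i, ChartOK X c i (K i) (E i) (I i)) (hreg : RegCond X c)
    (htw : TwistCond X c) {μ : Measure (Pt n)}
    {ρ : Pt n → ℝ} (hμ : μ = volume.withDensity (fun x => ENNReal.ofReal (ρ x)))
    (hρ : ContinuousOn ρ X) {ψ : Fin N → ℝ} (hG : ∀ j, 0 < Gfun X c μ ψ j) (i : Fin N) :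
    DifferentiableAt ℝ (fun ψ => Gfun X c μ ψ i) ψ := by
  have hvol : ∀ j, volume (LagCell X c ψ j) ≠ 0 := by
    intro j h0
    have hac : μ ≪ volume := by rw [hμ]; exact withDensity_absolutelyContinuous _ _
    have := hG j
    rw [Gfun, hac h0] at this
    simp at this
  obtain ⟨σ, hσ, hF⟩ := G_formula (h i) hreg hμ hρ
  have key := global_diff (ι := {k // k ≠ i}) (h i).cpt (h i).cv (h i).int
    (f := fun k => fch c i (E i) k) (D := fun k => Dch X c i (K i) (E i) k)
    (fun k q hq => (h i).hasD hreg k hq) (fun k => (h i).contD hreg k) ?_ hσ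
    (fun k => ψ k - ψ i) ?_ ?_
  · have hlin : DifferentiableAt ℝ (fun (ψ : Fin N → ℝ) (k : {k // k ≠ i}) => ψ k - ψ i) ψ := by
      fun_prop
    have := DifferentiableAt.comp ψ key hlin
    refine this.congr_of_eventuallyEq (Eventually.of_forall fun ψ' => ?_)
    exact hF ψ'
  · intro k q hq h0
    have h1 := (h i).D_comp k hq
    rw [show Dch X c i (K i) (E i) k q = 0 from h0, ContinuousLinearMap.zero_comp] at h1
    exact htw _ ((h i).bij.mapsTo hq) i k (Ne.symm k.2) (sub_eq_zero.1 h1.symm)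
  · intro q hq k l hkl hk hl s
    exact chart_pair h hreg htw hvol k.2 l.2 (fun e => hkl (Subtype.ext e)) hq hk hl s
  · intro q hq k hk ν hν0 hν s
    exact chart_bdry h hreg htw hvol k.2 hq hk hν0 hν s

lemma gfun_facts (t : ℝ) : ∃ s : ℝ, 1 ≤ s ∧ s ^ 2 = 1 + t ^ 2 ∧ 0 < s - t ∧ (s - t) * (s + t) = 1 ∧
    gfun t = 2 * s * (s - t) ∧ gfun t = 1 + (s - t) ^ 2 ∧
    HasDerivAt gfun (-(2 * (s - t) ^ 2 / s)) t := by
  have hp : 0 < 1 + t ^ 2 := by positivity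
  set s := Real.sqrt (1 + t ^ 2) with hs
  have hs2 : s ^ 2 = 1 + t ^ 2 := Real.sq_sqrt hp.le
  have hs0 : 0 ≤ s := Real.sqrt_nonneg _
  have hs1 : 1 ≤ s := by nlinarith [sq_nonneg t]
  have hst : 0 < s - t := by
    by_contra h
    push Not at h
    nlinarith
  have hg : gfun t = 2 * (1 + t ^ 2 - t * s) := rfl
  refine ⟨s, hs1, hs2, hst, by nlinarith, ?_, ?_, ?_⟩
  · rw [hg]; nlinarith
  · rw [hg]; nlinarith
  · have h1 : HasDerivAt (fun t : ℝ => 1 + t ^ 2) (2 * t) t := by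
      simpa using (hasDerivAt_pow 2 t).const_add 1
    have h2 : HasDerivAt (fun t : ℝ => Real.sqrt (1 + t ^ 2)) (2 * t / (2 * s)) t :=
      h1.sqrt hp.ne'
    have h3 := ((h1.sub ((hasDerivAt_id t).mul h2)).const_mul 2)
    refine h3.congr_deriv ?_
    have : s ≠ 0 := by linarith
    simp only [id, ← hs]
    field_simp
    nlinarith

lemma lin_alg {A : (Fin N → ℝ) →L[ℝ] (Fin N → ℝ)} {κ : ℝ} (hκ : 0 < κ)
    (h : ∀ (x : Fin N → ℝ) (i : Fin N), (∀ j, |x j| ≤ x i) → A x i ≤ -(κ * x i)) :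
    ∃ B : (Fin N → ℝ) ≃L[ℝ] (Fin N → ℝ), (B : (Fin N → ℝ) →L[ℝ] (Fin N → ℝ)) = A ∧
      ‖(B.symm : (Fin N → ℝ) →L[ℝ] (Fin N → ℝ))‖ ≤ κ⁻¹ := by
  have key : ∀ x, κ * ‖x‖ ≤ ‖A x‖ := by
    intro x
    rcases isEmpty_or_nonempty (Fin N) with hN | hN
    · have : x = 0 := Subsingleton.elim _ _
      simp [this]
    obtain ⟨i, hi⟩ := exists_eq_ciSup_of_finite (f := fun j => |x j|)
    have hmax : ∀ j, |x j| ≤ |x i| := fun j => by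
      have := le_ciSup (finite_range (fun j => |x j|)).bddAbove j
      rw [← hi] at this; exact this
    have hnorm : ‖x‖ ≤ |x i| := (pi_norm_le_iff_of_nonneg (abs_nonneg _)).2 hmax
    have hAi : |A x i| ≤ ‖A x‖ := norm_le_pi_norm (A x) i
    have h1 : κ * |x i| ≤ |A x i| := by
      rcases le_total 0 (x i) with h0 | h0
      · rw [abs_of_nonneg h0] at hmax ⊢
        have := h x i hmax
        linarith [neg_abs_le (A x i)]
      · rw [abs_of_nonpos h0] at hmax ⊢
        have := h (-x) i (fun j => by simpa using hmax j)
        simp only [map_neg, Pi.neg_apply] at this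
        linarith [le_abs_self (A x i)]
    exact (mul_le_mul_of_nonneg_left hnorm hκ.le).trans (h1.trans hAi)
  have hinj : Function.Injective A.toLinearMap := by
    rw [← LinearMap.ker_eq_bot, LinearMap.ker_eq_bot']
    intro x hx
    have h1 := key x
    rw [show A x = 0 from hx, norm_zero] at h1
    have : ‖x‖ ≤ 0 := by
      by_contra h2
      push Not at h2
      nlinarith [mul_pos hκ h2]
    exact norm_le_zero_iff.1 this
  set B := (LinearEquiv.ofInjectiveEndo A.toLinearMap hinj).toContinuousLinearEquiv with hB
  have hBA : ∀ x, B x = A x := fun x => rfl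
  refine ⟨B, by ext1 x; exact hBA x, ?_⟩
  refine ContinuousLinearMap.opNorm_le_bound _ (by positivity) fun y => ?_
  have h1 := key (B.symm y)
  rw [← hBA, B.apply_symm_apply] at h1
  rw [inv_mul_eq_div, le_div_iff₀ hκ, mul_comm]
  exact h1

lemma t_bound {M h ε : ℝ} {G t w : Fin N → ℝ} (hN : 1 ≤ N) (hM : 0 ≤ M) (hh : 0 < h) (hh1 : h ≤ 1)
    (hε : 0 < ε) (hε2 : ε < 1 / (2 * N)) (hw : ∀ i, w i ∈ Icc (0 : ℝ) 1) (hw1 : 1 ≤ ∑ i, w i)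
    (hG : ∀ i, ε < G i) (hG1 : ∑ i, G i = 1)
    (hsum : ∑ i, w i = ∑ i, (G i - ε) * gfun (t i)) (ht : ∀ i j, t i - t j ≤ M / h) (j : Fin N) :
    |t j| ≤ (N + 1 + M) * ε ^ (-(1 : ℝ) / 2) / h := by
  have hNr : (1 : ℝ) ≤ N := by exact_mod_cast hN
  have hNe : N * ε < 1 / 2 := by
    rw [lt_div_iff₀ (by positivity)] at hε2
    linarith
  have hε1 : ε < 1 := by nlinarith
  set a := ε ^ (-(1 : ℝ) / 2) with ha
  have ha0 : 0 < a := Real.rpow_pos_of_pos hε _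
  have ha2 : a ^ 2 * ε = 1 := by
    rw [ha, ← Real.rpow_natCast, ← Real.rpow_mul hε.le]
    norm_num
    rw [Real.rpow_neg_one, inv_mul_cancel₀ hε.ne']
  have ha1 : 1 ≤ a := by
    by_contra hc
    push Not at hc
    nlinarith
  have hsG : ∑ i, (G i - ε) = 1 - N * ε := by
    rw [Finset.sum_sub_distrib, hG1]; simp
  -- upper
  have hup : ∃ i, t i ≤ a := by
    by_contra hcon
    push Not at hcon
    have h1 : ∀ i, (G i - ε) * gfun (t i) ≤ (G i - ε) * (1 + ε) := by
      intro i
      refine mul_le_mul_of_nonneg_left ?_ (by linarith [hG i])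
      obtain ⟨s, hs1, hs2, hst, hmul, -, hg, -⟩ := gfun_facts (t i)
      rw [hg]
      have h2 : a ≤ s + t i := by linarith [hcon i]
      have h3 : (s - t i) * a ≤ 1 := by nlinarith
      have h4 : ((s - t i) * a) ^ 2 ≤ 1 := pow_le_one₀ (by positivity) h3
      have h5 : (s - t i) ^ 2 = ((s - t i) * a) ^ 2 * ε := by
        rw [mul_pow, mul_assoc, ha2, mul_one]
      nlinarith
    have h2 : ∑ i, (G i - ε) * gfun (t i) ≤ (1 - N * ε) * (1 + ε) := by
      rw [← hsG, Finset.sum_mul]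
      exact Finset.sum_le_sum fun i _ => h1 i
    rw [← hsum] at h2
    nlinarith
  have hlow : ∃ i, -(N : ℝ) ≤ t i := by
    by_contra hcon
    push Not at hcon
    have h1 : ∀ i, (G i - ε) * (2 * N) ≤ (G i - ε) * gfun (t i) := by
      intro i
      refine mul_le_mul_of_nonneg_left ?_ (by linarith [hG i])
      obtain ⟨s, hs1, hs2, hst, hmul, hg, -, -⟩ := gfun_facts (t i)
      rw [hg]
      have := hcon i
      nlinarith
    have h2 : (1 - N * ε) * (2 * N) ≤ ∑ i, (G i - ε) * gfun (t i) := by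
      rw [← hsG, Finset.sum_mul]
      exact Finset.sum_le_sum fun i _ => h1 i
    have h3 : ∑ i, w i ≤ N := by
      calc ∑ i, w i ≤ ∑ _i : Fin N, (1 : ℝ) := Finset.sum_le_sum fun i _ => (hw i).2
        _ = N := by simp
    rw [← hsum] at h2
    nlinarith
  obtain ⟨i1, hi1⟩ := hup
  obtain ⟨i2, hi2⟩ := hlow
  have e1 := ht j i1
  have e2 := ht i2 j
  have hah : a ≤ a / h := by rw [le_div_iff₀ hh]; nlinarith
  have hMh : M / h ≤ M * (a / h) := by
    rw [mul_div_assoc']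
    gcongr
    nlinarith
  have hNh : (N : ℝ) ≤ N * (a / h) := by nlinarith
  have hah0 : 0 < a / h := by positivity
  have : (N + 1 + M) * a / h = N * (a / h) + a / h + M * (a / h) := by ring
  rw [this, abs_le]
  constructor <;> linarith

lemma kappa_bound {t T ε₀ h b : ℝ} (hT : 1 ≤ T) (ht : |t| ≤ T) (hε : 0 < ε₀) (hh : 0 < h)
    (hb : 0 < b) (hw : ε₀ ≤ b * gfun t) :
    ∃ g' : ℝ, HasDerivAt gfun g' t ∧ 0 < gfun t ∧ ε₀ / (h * (6 * T ^ 3)) ≤ -(b * g' / h) := by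
  obtain ⟨s, hs1, hs2, hst, hmul, hg, hg1, hd⟩ := gfun_facts t
  refine ⟨_, hd, by rw [hg]; positivity, ?_⟩
  have hs0 : 0 < s := by linarith
  obtain ⟨ht1, ht2⟩ := abs_le.1 ht
  have hsp : 0 < s + t := by
    by_contra hc
    push Not at hc
    nlinarith
  have e1 : s - t = 1 / (s + t) := by rw [eq_div_iff hsp.ne']; exact hmul
  have hsT2 : s ^ 2 ≤ 2 * T ^ 2 := by nlinarith
  have hsT : s ≤ 2 * T := by nlinarith
  have h6 : s ^ 2 * (s + t) ≤ 6 * T ^ 3 := by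
    calc s ^ 2 * (s + t) ≤ (2 * T ^ 2) * (3 * T) := by
          apply mul_le_mul hsT2 (by linarith) hsp.le (by positivity)
      _ = 6 * T ^ 3 := by ring
  have e2 : -(b * -(2 * (s - t) ^ 2 / s) / h) = (b * gfun t) / (h * (s ^ 2 * (s + t))) := by
    rw [hg, e1]
    field_simp
  rw [e2]
  gcongr
  exact hε.le.trans hw

lemma charts_exist {X : Set (Pt n)} (hX : IsCompact X) {c : Pt n → Fin N → ℝ}
    (hvol : volume X ≠ 0) (hqc : LoeperCond X c) :
    ∃ (K : Fin N → Set (Pt n)) (E I : Fin N → Pt n → Pt n),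
      ∀ i, ChartOK X c i (K i) (E i) (I i) := by
  obtain ⟨K, E, I, h⟩ := hqc
  refine ⟨K, E, I, fun i => ?_⟩
  obtain ⟨h1, h2, h3, h4, h5, h6⟩ := h i
  have himg : I i '' X = K i := by
    rw [← h4.image_eq, h5.1.image_image]
  have hcpt : IsCompact (K i) := by
    rw [← himg]; exact hX.image_of_continuousOn h3.continuousOn
  exact ⟨h1, hcpt, chart_int h1 hcpt (h2.differentiableOn (by norm_num)) h4.image_eq hvol,
    h2, h3, h4, h5, h6⟩

lemma lag_closed {X : Set (Pt n)} (hX : IsCompact X) {c : Pt n → Fin N → ℝ}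
    (hreg : RegCond X c) (ψ : Fin N → ℝ) (i : Fin N) : IsClosed (LagCell X c ψ i) := by
  have h1 : LagCell X c ψ i = {x | x ∈ X ∧ ∀ k, -c x k + c x i ≤ ψ k - ψ i} := by
    ext x; exact lag_iff
  rw [h1]
  exact closed_cell (f := fun k x => -c x k + c x i) hX.isClosed
    (fun k => (hreg k).continuousOn.neg.add (hreg i).continuousOn) (fun k => ψ k - ψ i)

lemma lag_overlap {X : Set (Pt n)} {c : Pt n → Fin N → ℝ}
    (hreg : RegCond X c) (htw : TwistCond X c) (ψ : Fin N → ℝ) {i k : Fin N} (hik : i ≠ k) :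
    volume (LagCell X c ψ i ∩ LagCell X c ψ k) = 0 := by
  apply null_of_oneSided
  rintro x ⟨hx, hx'⟩
  have hxX := (lag_iff.1 hx).1
  refine ⟨bch X c i x - bch X c k x, sub_ne_zero.2 (htw x hxX i k hik), fun η hη => ?_⟩
  have hu : HasFDerivWithinAt (fun y => c y i - c y k)
      (bch X c i x - bch X c k x) X x :=
    ((((hreg i).differentiableOn (by norm_num)) x hxX).hasFDerivWithinAt).sub
      (((hreg k).differentiableOn (by norm_num)) x hxX).hasFDerivWithinAt
  have hsub : LagCell X c ψ i ∩ LagCell X c ψ k ⊆ X := fun y hy => (lag_iff.1 hy.1).1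
  have hval : ∀ y ∈ LagCell X c ψ i ∩ LagCell X c ψ k, c y i - c y k = ψ k - ψ i := by
    intro y hy
    have a1 := (lag_iff.1 hy.1).2 k
    have a2 := (lag_iff.1 hy.2).2 i
    linarith
  filter_upwards [(hu.mono hsub).isLittleO.def hη, self_mem_nhdsWithin] with y h2 h3
  rw [hval y h3, hval x ⟨hx, hx'⟩, sub_self, zero_sub, norm_neg] at h2
  exact (le_abs_self _).trans h2

lemma sum_G {X : Set (Pt n)} (hX : IsCompact X) {c : Pt n → Fin N → ℝ} (hN : 1 ≤ N)
    (hreg : RegCond X c) (htw : TwistCond X c) {μ : Measure (Pt n)} (hprob : IsProbabilityMeasure μ)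
    (hac : μ ≪ volume) (hsupp : μ Xᶜ = 0) (ψ : Fin N → ℝ) : ∑ i, Gfun X c μ ψ i = 1 := by
  have hcov : ⋃ i, LagCell X c ψ i = X := by
    ext x
    rw [mem_iUnion]
    constructor
    · rintro ⟨i, hi⟩; exact (lag_iff.1 hi).1
    · intro hx
      have : Nonempty (Fin N) := ⟨⟨0, hN⟩⟩
      obtain ⟨i, hi⟩ := exists_eq_ciSup_of_finite (f := fun j => -c x j - ψ j)
      exact ⟨i, hx, hi⟩
  have hd : Pairwise (Function.onFun (AEDisjoint μ) fun i => LagCell X c ψ i) := by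
    intro i k hik
    exact hac (lag_overlap hreg htw ψ hik)
  have h1 := measure_iUnion₀ hd (fun i => (lag_closed hX hreg ψ i).measurableSet.nullMeasurableSet)
  rw [hcov, tsum_fintype] at h1
  have h2 : μ X = 1 := (prob_compl_eq_zero_iff hX.isClosed.measurableSet).1 hsupp
  simp only [Gfun]
  rw [← ENNReal.toReal_sum (fun i _ => measure_ne_top _ _), ← h1, h2, ENNReal.toReal_one]

lemma dG_nonpos {X : Set (Pt n)} {c : Pt n → Fin N → ℝ} {μ : Measure (Pt n)}
    (hprob : IsProbabilityMeasure μ) {ψ : Fin N → ℝ} {i : Fin N}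
    {L : (Fin N → ℝ) →L[ℝ] ℝ} (hL : HasFDerivAt (fun ψ => Gfun X c μ ψ i) L ψ)
    {x : Fin N → ℝ} (hx : ∀ j, x j ≤ x i) : L x ≤ 0 := by
  have hmono : ∀ τ : ℝ, 0 ≤ τ → Gfun X c μ (ψ + τ • x) i ≤ Gfun X c μ ψ i := by
    intro τ hτ
    refine ENNReal.toReal_mono (measure_ne_top _ _) (measure_mono ?_)
    intro y hy
    rw [lag_iff] at hy ⊢
    refine ⟨hy.1, fun k => ?_⟩
    have h1 := hy.2 k
    simp only [Pi.add_apply, Pi.smul_apply, smul_eq_mul] at h1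
    nlinarith [hx k]
  have hmax : IsLocalMaxOn (fun ψ => Gfun X c μ ψ i) (segment ℝ ψ (ψ + x)) ψ := by
    have : IsMaxOn (fun ψ => Gfun X c μ ψ i) (segment ℝ ψ (ψ + x)) ψ := by
      intro y hy
      rw [segment_eq_image'] at hy
      obtain ⟨τ, hτ, rfl⟩ := hy
      have := hmono τ hτ.1
      simpa using this
    exact this.localize
  have := hmax.hasFDerivWithinAt_nonpos hL.hasFDerivWithinAt
    (mem_posTangentConeAt_of_segment_subset (y := x) (subset_rfl))
  exact this

lemma psi_bound {X : Set (Pt n)} (hX : IsCompact X) {c : Pt n → Fin N → ℝ}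
    (hreg : RegCond X c) (μ : Measure (Pt n)) :
    ∃ M : ℝ, 0 ≤ M ∧ ∀ ψ : Fin N → ℝ, (∀ i, 0 < Gfun X c μ ψ i) → ∀ i j, ψ i - ψ j ≤ M := by
  choose B hB using fun i => hX.exists_bound_of_continuousOn (hreg i).continuousOn
  obtain ⟨M, hM⟩ := (finite_range B).bddAbove
  have hM' : ∀ x ∈ X, ∀ i, |c x i| ≤ M := fun x hx i => (hB i x hx).trans (hM (mem_range_self i))
  refine ⟨2 * max M 0, by positivity, fun ψ hψ i j => ?_⟩
  have hne : (LagCell X c ψ i).Nonempty := by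
    by_contra hcon
    rw [not_nonempty_iff_eq_empty] at hcon
    have := hψ i
    rw [Gfun, hcon] at this
    simp at this
  obtain ⟨x, hx⟩ := hne
  obtain ⟨hxX, h1⟩ := lag_iff.1 hx
  have a1 := h1 j
  have a2 := abs_le.1 (hM' x hxX i)
  have a3 := abs_le.1 (hM' x hxX j)
  have := le_max_left M 0
  linarith

lemma w_deriv {X : Set (Pt n)} {c : Pt n → Fin N → ℝ} {μ : Measure (Pt n)} {h ε : ℝ}
    {ψ : Fin N → ℝ} (hG : ∀ i, DifferentiableAt ℝ (fun ψ => Gfun X c μ ψ i) ψ) (g' : Fin N → ℝ)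
    (hg : ∀ i, HasDerivAt gfun (g' i) (ψ i / h)) :
    DifferentiableAt ℝ (wmap X c μ h ε) ψ ∧ ∀ x i, fderiv ℝ (wmap X c μ h ε) ψ x i =
      fderiv ℝ (fun ψ => Gfun X c μ ψ i) ψ x * gfun (ψ i / h) +
        (Gfun X c μ ψ i - ε) * g' i / h * x i := by
  have hcomp : ∀ i, HasFDerivAt (fun ψ : Fin N → ℝ => gfun (ψ i / h))
      ((g' i) • (h⁻¹ • (ContinuousLinearMap.proj (R := ℝ) (φ := fun _ : Fin N => ℝ) i))) ψ := by
    intro i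
    have h1 : HasFDerivAt (fun ψ : Fin N → ℝ => ψ i / h)
        (h⁻¹ • (ContinuousLinearMap.proj (R := ℝ) (φ := fun _ : Fin N => ℝ) i)) ψ := by
      have := (hasFDerivAt_apply (𝕜 := ℝ) i ψ).mul_const h⁻¹
      simpa only [div_eq_mul_inv] using this
    have h2 := HasDerivAt.comp_hasFDerivAt (h₂ := gfun) (f := fun ψ : Fin N → ℝ => ψ i / h) ψ (hg i) h1
    exact h2
  have hw : ∀ i, HasFDerivAt (fun ψ => wmap X c μ h ε ψ i) _ ψ := fun i =>
    ((hG i).hasFDerivAt.sub_const ε).mul (hcomp i)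
  have hW := hasFDerivAt_pi.2 hw
  refine ⟨hW.differentiableAt, fun x i => ?_⟩
  have : fderiv ℝ (wmap X c μ h ε) ψ = _ := hW.fderiv
  rw [this]
  simp
  ring

theorem stmt11
    (n N : ℕ) (hn : 2 ≤ n) (hN : 1 ≤ N)
    (X : Set (Pt n)) (hX : IsCompact X)
    (Y : Fin N → Pt n) (hY : Function.Injective Y)
    (c : Pt n → Fin N → ℝ) (hreg : RegCond X c) (htw : TwistCond X c)
    (μ : Measure (Pt n)) (hprob : IsProbabilityMeasure μ)
    (hac : μ ≪ volume) (hsupp : μ Xᶜ = 0)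
    (hqc : LoeperCond X c)
    (α : ℝ) (hα : 0 < α) (hα1 : α ≤ 1)
    (hdens : HolderDensity X μ α) :
    ∃ C > (0:ℝ), ∀ (h ε ε₀ : ℝ) (w : Fin N → ℝ),
      0 < h → h ≤ 1 → 0 < ε → ε < 1 / (2 * N) → 0 < ε₀ →
      (∀ i, w i ∈ Icc (0:ℝ) 1) → 1 ≤ ∑ i, w i →
      (∀ ψ ∈ Kset X c μ ε, DifferentiableAt ℝ (wmap X c μ h ε) ψ) ∧
      ∀ ψ ∈ Nset X c μ h ε w ∩ Wset X c μ h ε ε₀,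
        ∃ A : (Fin N → ℝ) ≃L[ℝ] (Fin N → ℝ),
          (A : (Fin N → ℝ) →L[ℝ] (Fin N → ℝ)) = fderiv ℝ (wmap X c μ h ε) ψ ∧
          ‖(A.symm : (Fin N → ℝ) →L[ℝ] (Fin N → ℝ))‖ ≤
            C * ε₀⁻¹ * h ^ (-6 : ℝ) * ε ^ (-(3:ℝ) / 2) := by
  obtain ⟨ρ, hμ, hρ, -⟩ := hdens
  have hvX : volume X ≠ 0 := by
    intro h0
    have h1 : μ X = 1 := (prob_compl_eq_zero_iff hX.isClosed.measurableSet).1 hsupp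
    rw [hac h0] at h1
    exact zero_ne_one h1
  obtain ⟨K, E, I, hch⟩ := charts_exist hX hvX hqc
  obtain ⟨M, hM0, hM⟩ := psi_bound hX hreg μ
  refine ⟨6 * (N + 1 + M) ^ 3, by positivity, ?_⟩
  intro h ε ε₀ w hh hh1 hε hε2 hε₀ hw hw1
  have hGd : ∀ ψ ∈ Kset X c μ ε, ∀ i, DifferentiableAt ℝ (fun ψ => Gfun X c μ ψ i) ψ :=
    fun ψ hψ i => G_diff hch hreg htw hμ hρ (fun j => hε.trans (hψ j)) i
  refine ⟨fun ψ hψ => ?_, ?_⟩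
  · choose s h1 h2 h3 h4 h5 h6 h7 using fun i => gfun_facts (ψ i / h)
    exact (w_deriv (hGd ψ hψ) _ h7).1
  rintro ψ ⟨⟨hK, hs⟩, hW⟩
  set T : ℝ := (N + 1 + M) * ε ^ (-(1 : ℝ) / 2) / h with hT
  have hNr : (1 : ℝ) ≤ N := by exact_mod_cast hN
  have hNe : N * ε < 1 / 2 := by
    rw [lt_div_iff₀ (by positivity)] at hε2
    linarith
  have hε1 : ε ≤ 1 := by nlinarith
  have ha1 : 1 ≤ ε ^ (-(1 : ℝ) / 2) :=
    Real.one_le_rpow_of_pos_of_le_one_of_nonpos hε hε1 (by norm_num)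
  have hT1 : 1 ≤ T := by
    rw [hT, le_div_iff₀ hh]
    nlinarith
  have ht : ∀ j, |ψ j / h| ≤ T := by
    refine t_bound (t := fun j => ψ j / h) hN hM0 hh hh1 hε hε2 hw hw1 hK
      (sum_G hX hN hreg htw hprob hac hsupp ψ) hs ?_
    intro i j
    rw [← sub_div]
    gcongr
    exact hM ψ (fun j => hε.trans (hK j)) i j
  choose g' hg' hgpos hκ using fun i => kappa_bound hT1 (ht i) hε₀ hh
    (sub_pos.2 (hK i)) (hW i)
  obtain ⟨_, hform⟩ := w_deriv (h := h) (ε := ε) (hGd ψ hK) g' hg'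
  have hκ0 : 0 < ε₀ / (h * (6 * T ^ 3)) := by positivity
  obtain ⟨B, hB1, hB2⟩ := lin_alg (A := fderiv ℝ (wmap X c μ h ε) ψ) hκ0 (by
    intro x i hx
    rw [hform]
    have h1 := dG_nonpos hprob ((hGd ψ hK i).hasFDerivAt) (x := x)
      (fun j => (le_abs_self _).trans (hx j))
    have h2 : 0 ≤ x i := (abs_nonneg _).trans (hx i)
    have h3 := mul_nonpos_of_nonpos_of_nonneg h1 (hgpos i).le
    have h4 := mul_le_mul_of_nonneg_right (hκ i) h2
    linarith)
  refine ⟨B, hB1, hB2.trans ?_⟩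
  have e1 : (ε ^ (-(1 : ℝ) / 2)) ^ 3 = ε ^ (-(3 : ℝ) / 2) := by
    rw [← Real.rpow_natCast, ← Real.rpow_mul hε.le]
    norm_num
  have e2 : h ^ (-6 : ℝ) = (h ^ 6)⁻¹ := by
    rw [Real.rpow_neg hh.le]
    norm_cast
  have e3 : (ε₀ / (h * (6 * T ^ 3)))⁻¹ =
      6 * (N + 1 + M) ^ 3 * ε₀⁻¹ * (h ^ 2)⁻¹ * ε ^ (-(3 : ℝ) / 2) := by
    rw [hT, ← e1]
    field_simp
  rw [e3, e2]
  have e4 : (h ^ 2)⁻¹ ≤ (h ^ 6)⁻¹ := by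
    gcongr ?_⁻¹
    exact pow_le_pow_of_le_one hh.le hh1 (by norm_num)
  gcongr
end
end

section
/- Let h > 0, ε ∈ (0,1/(2N)), and w ∈ ℝᴺ with wⁱ ≥ 0 for all i and Σ_i wⁱ ≥ 1. Then for every ψ ∈ 𝒦^ε there exists a unique r ∈ ℝ such that ψ − r·𝟙 ∈ 𝒩_{w,h,ε}, where 𝟙 = (1,…,1) ∈ ℝᴺ; equivalently, there is a unique r ∈ ℝ with Σ_{i=1}^N (Gⁱ(ψ) − ε)·g((ψⁱ − r)/h) = Σ_{i=1}^N wⁱ. -/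
open MeasureTheory Metric Set Filter
open scoped Classical

noncomputable section

variable {n N : ℕ}

lemma gfun_eq (t : ℝ) : gfun t = 1 + Real.exp (-(2 * Real.arsinh t)) := by
  have h1 : Real.exp (-(2 * Real.arsinh t)) = Real.exp (Real.arsinh (-t)) ^ 2 := by
    rw [← Real.exp_nat_mul, Real.arsinh_neg]; congr 1; push_cast; ring
  rw [h1, Real.exp_arsinh, gfun]
  have h2 : Real.sqrt (1 + t ^ 2) ^ 2 = 1 + t ^ 2 := Real.sq_sqrt (by positivity)
  rw [neg_sq]
  nlinarith

lemma mem_LagCell {n N : ℕ} (X : Set (Pt n)) (c : Pt n → Fin N → ℝ) (ψ : Fin N → ℝ)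
    (i : Fin N) (x : Pt n) :
    x ∈ LagCell X c ψ i ↔ x ∈ X ∧ ∀ j, -c x j - ψ j ≤ -c x i - ψ i := by
  have hb : BddAbove (range fun j => -c x j - ψ j) := (Set.finite_range _).bddAbove
  haveI : Nonempty (Fin N) := ⟨i⟩
  simp only [LagCell, mem_setOf_eq]
  refine and_congr_right fun _ => ⟨fun h j => ?_, fun h => le_antisymm ?_ ?_⟩
  · rw [h]; exact le_ciSup hb j
  · exact le_ciSup hb i
  · exact ciSup_le h

lemma Gfun_shift {n N : ℕ} (X : Set (Pt n)) (c : Pt n → Fin N → ℝ) (μ : Measure (Pt n))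
    (ψ : Fin N → ℝ) (r : ℝ) :
    Gfun X c μ (ψ - r • (fun _ => (1:ℝ))) = Gfun X c μ ψ := by
  funext i
  have : LagCell X c (ψ - r • (fun _ => (1:ℝ))) i = LagCell X c ψ i := by
    ext x
    simp only [mem_LagCell, Pi.sub_apply, Pi.smul_apply, smul_eq_mul, mul_one]
    refine and_congr_right fun _ => forall_congr' fun j => ?_
    constructor <;> intro h <;> linarith
  rw [Gfun, this, Gfun]

lemma level_null {n N : ℕ} (hn : 2 ≤ n) (X : Set (Pt n)) (hX : IsCompact X)
    (c : Pt n → Fin N → ℝ) (hreg : RegCond X c) (htw : TwistCond X c)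
    (i k : Fin N) (hik : i ≠ k) (a : ℝ) :
    volume {x ∈ X | c x i - c x k = a} = 0 := by
  set S := {x ∈ X | c x i - c x k = a} with hS
  have hcont : ContinuousOn (fun x => c x i - c x k) X :=
    (hreg i).continuousOn.sub (hreg k).continuousOn
  have hSc : IsClosed S := by
    have := hcont.preimage_isClosed_of_isClosed hX.isClosed (isClosed_singleton (x := a))
    exact this
  let v : Pt n := EuclideanSpace.single ⟨0, by omega⟩ 1
  have hv : v ≠ 0 := by
    intro h
    have := congrArg norm h
    simp [v] at this
  let D : Pt n → (Pt n →L[ℝ] ℝ) := fun x =>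
    fderivWithin ℝ (fun y => c y i) X x - fderivWithin ℝ (fun y => c y k) X x
  have hD : ∀ x ∈ S, HasFDerivWithinAt (fun x => (c x i - c x k) • v) ((D x).smulRight v) S x := by
    intro x hx
    have h1 := (((hreg i).differentiableOn (by norm_num)) x hx.1).hasFDerivWithinAt
    have h2 := (((hreg k).differentiableOn (by norm_num)) x hx.1).hasFDerivWithinAt
    exact ((h1.sub h2).smul_const v).mono (fun y hy => hy.1)
  have hA : ApproximatesLinearOn (fun x => (c x i - c x k) • v) (0 : Pt n →L[ℝ] Pt n) S 0 := by
    intro x hx y hy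
    simp [hx.2, hy.2]
  have hae := hA.norm_fderiv_sub_le volume hSc.measurableSet _ hD
  have hfalse : ∀ᵐ x ∂(volume.restrict S), False := by
    filter_upwards [hae, ae_restrict_mem hSc.measurableSet] with x hx hxS
    have h0 : D x = 0 := by simpa [hv] using hx
    apply htw x hxS.1 i k hik
    exact sub_eq_zero.1 h0
  have h3 : volume.restrict S = 0 := by
    simpa [ae_eq_bot] using (Filter.eventually_false_iff_eq_bot.1 hfalse)
  simpa using h3

lemma sum_G_le {n N : ℕ} (hn : 2 ≤ n) (X : Set (Pt n)) (hX : IsCompact X)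
    (c : Pt n → Fin N → ℝ) (hreg : RegCond X c) (htw : TwistCond X c)
    (μ : Measure (Pt n)) (hprob : IsProbabilityMeasure μ) (hac : μ ≪ volume)
    (ψ : Fin N → ℝ) : ∑ i, Gfun X c μ ψ i ≤ 1 := by
  have hcl : ∀ i, IsClosed (LagCell X c ψ i) := by
    intro i
    have : LagCell X c ψ i = X ∩ ⋂ j, {x ∈ X | -c x j - ψ j ≤ -c x i - ψ i} := by
      ext x
      simp only [mem_LagCell, mem_inter_iff, mem_iInter, mem_setOf_eq]
      constructor
      · rintro ⟨h1, h2⟩; exact ⟨h1, fun j => ⟨h1, h2 j⟩⟩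
      · rintro ⟨h1, h2⟩; exact ⟨h1, fun j => (h2 j).2⟩
    rw [this]
    refine hX.isClosed.inter (isClosed_iInter fun j => ?_)
    exact hX.isClosed.isClosed_le ((hreg j).continuousOn.neg.sub continuousOn_const)
      ((hreg i).continuousOn.neg.sub continuousOn_const)
  have hle : ∑ i ∈ Finset.univ, μ (LagCell X c ψ i) ≤ μ univ := by
    refine sum_measure_le_measure_univ (fun i _ => (hcl i).measurableSet.nullMeasurableSet) ?_
    intro i _ k _ hik
    refine measure_mono_null ?_ (hac (level_null hn X hX c hreg htw i k hik (ψ k - ψ i)))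
    rintro x ⟨h1, h2⟩
    rw [mem_LagCell] at h1 h2
    refine ⟨h1.1, ?_⟩
    have := h1.2 k
    have := h2.2 i
    linarith
  rw [measure_univ] at hle
  have : ∑ i, Gfun X c μ ψ i = (∑ i, μ (LagCell X c ψ i)).toReal := by
    rw [ENNReal.toReal_sum (fun i _ => measure_ne_top _ _)]; rfl
  rw [this]
  exact ENNReal.toReal_le_of_le_ofReal zero_le_one (by simpa using hle)

lemma arsinh_atTop : Tendsto Real.arsinh atTop atTop :=
  Real.arsinh_strictMono.monotone.tendsto_atTop_atTop
    fun b => (Real.arsinh_surjective b).imp fun _ h => h.ge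

lemma arsinh_atBot : Tendsto Real.arsinh atBot atBot :=
  Real.arsinh_strictMono.monotone.tendsto_atBot_atBot
    fun b => (Real.arsinh_surjective b).imp fun _ h => h.le

theorem stmt13
    (n N : ℕ) (hn : 2 ≤ n) (hN : 1 ≤ N)
    (X : Set (Pt n)) (hX : IsCompact X)
    (Y : Fin N → Pt n) (hY : Function.Injective Y)
    (c : Pt n → Fin N → ℝ) (hreg : RegCond X c) (htw : TwistCond X c)
    (μ : Measure (Pt n)) (hprob : IsProbabilityMeasure μ)
    (hac : μ ≪ volume) (hsupp : μ Xᶜ = 0) :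
    ∀ (h ε : ℝ) (w : Fin N → ℝ),
      0 < h → 0 < ε → ε < 1 / (2 * N) → (∀ i, 0 ≤ w i) → 1 ≤ ∑ i, w i →
      ∀ ψ ∈ Kset X c μ ε,
        ∃! r : ℝ, (ψ - r • (fun _ => (1:ℝ))) ∈ Nset X c μ h ε w := by
  intro h ε w hh hε _ _ hw ψ hψ
  haveI : Nonempty (Fin N) := ⟨⟨0, hN⟩⟩
  have hG := sum_G_le hn X hX c hreg htw μ hprob hac ψ
  set a : Fin N → ℝ := fun i => Gfun X c μ ψ i - ε with ha
  have hapos : ∀ i, 0 < a i := fun i => sub_pos.2 (hψ i)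
  have hasum : ∑ i, a i < ∑ i, w i := by
    have h1 : ∑ i, a i < ∑ i, Gfun X c μ ψ i :=
      Finset.sum_lt_sum_of_nonempty Finset.univ_nonempty (fun i _ => by simp [ha, hε])
    linarith
  let Φ : ℝ → ℝ := fun r => ∑ i, a i * (1 + Real.exp (-(2 * Real.arsinh ((ψ i - r) / h))))
  have hmem : ∀ r : ℝ, (ψ - r • (fun _ => (1:ℝ))) ∈ Nset X c μ h ε w ↔ Φ r = ∑ i, w i := by
    intro r
    have hK : (ψ - r • (fun _ => (1:ℝ))) ∈ Kset X c μ ε := by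
      intro i; rw [Gfun_shift]; exact hψ i
    have hs : ∑ i, wmap X c μ h ε (ψ - r • (fun _ => (1:ℝ))) i = Φ r := by
      refine Finset.sum_congr rfl fun i _ => ?_
      simp [wmap, Gfun_shift, gfun_eq, ha]
    constructor
    · intro hm; rw [← hs]; exact hm.2.symm
    · intro hm; exact ⟨hK, by rw [hs, hm]⟩
  have hmono : StrictMono Φ := by
    intro r s hrs
    refine Finset.sum_lt_sum_of_nonempty Finset.univ_nonempty fun i _ => ?_
    refine mul_lt_mul_of_pos_left ?_ (hapos i)
    have h1 : (ψ i - s) / h < (ψ i - r) / h := by gcongr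
    have h2 := Real.arsinh_strictMono h1
    have h3 := Real.exp_lt_exp.2 (show -(2 * Real.arsinh ((ψ i - r) / h)) <
      -(2 * Real.arsinh ((ψ i - s) / h)) by linarith)
    linarith
  have hcont : Continuous Φ := by
    refine continuous_finsetSum _ fun i _ => ?_
    have : Continuous fun r => Real.arsinh ((ψ i - r) / h) :=
      Real.continuous_arsinh.comp (by fun_prop)
    fun_prop
  have hbot : Tendsto Φ atBot (nhds (∑ i, a i)) := by
    refine tendsto_finsetSum _ fun i _ => ?_
    have h1 : Tendsto (fun r => (ψ i - r) / h) atBot atTop :=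
      (tendsto_atTop_add_const_left _ (ψ i) tendsto_neg_atBot_atTop).atTop_div_const hh
    have h2 := (arsinh_atTop.comp h1).const_mul_atTop (zero_lt_two (α := ℝ))
    have h3 := Real.tendsto_exp_neg_atTop_nhds_zero.comp h2
    simpa using (h3.const_add 1).const_mul (a i)
  have htop : Tendsto Φ atTop atTop := by
    obtain ⟨i⟩ := ‹Nonempty (Fin N)›
    have h1 : Tendsto (fun r => (ψ i - r) / h) atTop atBot :=
      (tendsto_atBot_add_const_left _ (ψ i) tendsto_neg_atTop_atBot).atBot_div_const hh
    have h2 := (arsinh_atBot.comp h1).const_mul_atBot (zero_lt_two (α := ℝ))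
    have h3 := Real.tendsto_exp_atTop.comp (tendsto_neg_atBot_atTop.comp h2)
    have h4 := (tendsto_atTop_add_const_left _ (1:ℝ) h3).const_mul_atTop (hapos i)
    refine tendsto_atTop_mono (fun r => ?_) h4
    exact Finset.single_le_sum
      (f := fun i => a i * (1 + Real.exp (-(2 * Real.arsinh ((ψ i - r) / h)))))
      (fun j _ => mul_nonneg (hapos j).le (by positivity)) (Finset.mem_univ i)
  obtain ⟨r, hr⟩ : (∑ i, w i) ∈ range Φ :=
    mem_range_of_exists_le_of_exists_ge hcont
      ((hbot.eventually (gt_mem_nhds hasum)).exists.imp fun _ h => le_of_lt h)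
      (htop.eventually (eventually_ge_atTop _)).exists
  refine ⟨r, (hmem r).2 hr, fun s hs => hmono.injective ?_⟩
  rw [(hmem s).1 hs, hr]
end
end
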